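/- arXiv:2010.12018 — 10 statements merged into one kernel-verified Lean document; each statement's English description precedes it below -/
import Mathlib

section
/- Let 𝒮 be an elimination system on R×E. If (S,F) is covered by (T,G) in the poset P(𝒮) (i.e. (S,F) < (T,G) and no element of P(𝒮) lies strictly between them), then either F = G and |supp(S)| = |supp(T)| − 1, or S = T and |F| = |G| + 1. -/
/-! Statement 0: In the poset `P(𝒮)` of an elimination system `𝒮` on `R × E`,
if `(S,F)` is covered by `(T,G)`, then either `F = G` and `|supp S| = |supp T| - 1`,
or `S = T` and `|F| = |G| + 1`. -/

/-- The order on sign vectors: `S ≤ T` iff `S i = T i` for every `i` in the support of `S`. -/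
def SVLe {R : Type*} (S T : R → SignType) : Prop := ∀ i, S i ≠ 0 → S i = T i

/-- `𝒮` is an elimination system on `R × E`. -/
structure IsElimSystem {R E : Type*} (𝒮 : Set (Finset (R × E))) : Prop where
  E1 : ∀ F ∈ 𝒮, ∀ j : E, ∃ i : R, (i, j) ∈ F
  E2 : ∀ F G : Finset (R × E), G ∈ 𝒮 → F ⊆ G → (∀ j : E, ∃ i : R, (i, j) ∈ F) → F ∈ 𝒮
  E3 : ∀ F ∈ 𝒮, ∀ G ∈ 𝒮, ∀ j : E, ∃ H ∈ 𝒮,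
      (∀ i : R, ((i, j) ∈ H ↔ (i, j) ∈ F ∨ (i, j) ∈ G)) ∧
      ∀ k : E, k ≠ j →
        ((∀ i : R, ((i, k) ∈ H ↔ (i, k) ∈ F)) ∨
         (∀ i : R, ((i, k) ∈ H ↔ (i, k) ∈ G)) ∨
         (∀ i : R, ((i, k) ∈ H ↔ (i, k) ∈ F ∨ (i, k) ∈ G)))

/-- Membership in the poset `P(𝒮)`: pairs `(S, F)` with `F ∈ 𝒮` and `supp_R F ⊆ supp S`. -/
def memP {R E : Type*} (𝒮 : Set (Finset (R × E))) (p : (R → SignType) × Finset (R × E)) : Prop :=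
  p.2 ∈ 𝒮 ∧ ∀ i j, (i, j) ∈ p.2 → p.1 i ≠ 0

/-- The order of `P(𝒮)`: `(S,F) ≤ (T,G)` iff `S ≤ T` and `F ⊇ G`. -/
def PLe {R E : Type*} (p q : (R → SignType) × Finset (R × E)) : Prop :=
  SVLe p.1 q.1 ∧ q.2 ⊆ p.2

/-- Covering relation of `P(𝒮)`: `p < q` and no element of `P(𝒮)` strictly in between. -/
def PCovBy {R E : Type*} (𝒮 : Set (Finset (R × E)))
    (p q : (R → SignType) × Finset (R × E)) : Prop :=
  memP 𝒮 p ∧ memP 𝒮 q ∧ PLe p q ∧ p ≠ q ∧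
    ¬ ∃ r, memP 𝒮 r ∧ PLe p r ∧ PLe r q ∧ r ≠ p ∧ r ≠ q

/-- The cardinality of the support of a sign vector. -/
def suppCard {R : Type*} [Fintype R] (S : R → SignType) : ℕ :=
  (Finset.univ.filter fun i => S i ≠ 0).card

theorem statement0 {R E : Type*} [Fintype R] [Fintype E]
    (𝒮 : Set (Finset (R × E))) (h𝒮 : IsElimSystem 𝒮)
    (p q : (R → SignType) × Finset (R × E)) (hcov : PCovBy 𝒮 p q) :
    (p.2 = q.2 ∧ suppCard p.1 + 1 = suppCard q.1) ∨
      (p.1 = q.1 ∧ p.2.card = q.2.card + 1) := by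
  classical
  obtain ⟨S, F⟩ := p
  obtain ⟨T, G⟩ := q
  obtain ⟨⟨hF, hS⟩, ⟨hG, hT⟩, ⟨hST, hGF⟩, hne, hno⟩ := hcov
  simp only at hF hS hG hT hST hGF ⊢
  by_cases hEq : S = T
  · right
    subst hEq
    refine ⟨rfl, ?_⟩
    have hFG : ¬ F ⊆ G := fun h => hne (by rw [Finset.Subset.antisymm h hGF])
    obtain ⟨x, hxF, hxG⟩ := Finset.not_subset.mp hFG
    have hGe : G ⊆ F.erase x := fun y hy =>
      Finset.mem_erase.mpr ⟨fun h => hxG (h ▸ hy), hGF hy⟩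
    have hr : F.erase x = G := by
      by_contra hc
      refine hno ⟨(S, F.erase x), ⟨?_, ?_⟩, ⟨fun i _ => rfl, Finset.erase_subset _ _⟩,
        ⟨fun i _ => rfl, hGe⟩, ?_, ?_⟩
      · refine h𝒮.E2 _ F hF (Finset.erase_subset _ _) fun j => ?_
        obtain ⟨i, hi⟩ := h𝒮.E1 G hG j
        exact ⟨i, hGe hi⟩
      · intro i j h
        exact hS i j (Finset.mem_of_mem_erase h)
      · intro h
        have h2 : F.erase x = F := congrArg Prod.snd h
        exact Finset.notMem_erase x F (h2.symm ▸ hxF)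
      · intro h
        exact hc (congrArg Prod.snd h)
    rw [← hr, Finset.card_erase_add_one hxF]
  · left
    obtain ⟨i, hi⟩ := Function.ne_iff.mp hEq
    have hSi : S i = 0 := by
      by_contra h
      exact hi (hST i h)
    have hTi : T i ≠ 0 := fun h => hi (hSi.trans h.symm)
    have hr : (Function.update S i (T i), F) = (T, G) := by
      by_contra hc
      refine hno ⟨(Function.update S i (T i), F), ⟨hF, ?_⟩, ⟨?_, subset_rfl⟩,
        ⟨?_, hGF⟩, ?_, hc⟩
      · intro k j h
        by_cases hk : k = i
        · subst hk
          simpa using hTi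
        · simpa [hk] using hS k j h
      · intro k h
        have hk : k ≠ i := fun hk => h (hk ▸ hSi)
        simp [hk]
      · intro k h
        by_cases hk : k = i
        · subst hk
          simp
        · simp only [Function.update_of_ne hk] at h ⊢
          exact hST k h
      · intro h
        have h2 := congrFun (congrArg Prod.fst h) i
        simp only [Function.update_self] at h2
        exact hi h2.symm
    have h1 : Function.update S i (T i) = T := congrArg Prod.fst hr
    refine ⟨congrArg Prod.snd hr, ?_⟩
    unfold suppCard
    have hins : (Finset.univ.filter fun k => T k ≠ 0)
        = insert i (Finset.univ.filter fun k => S k ≠ 0) := by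
      ext k
      by_cases hk : k = i
      · subst hk
        simp [hTi]
      · have h3 := congrFun h1 k
        rw [Function.update_of_ne hk] at h3
        simp [hk, h3]
    rw [hins, Finset.card_insert_of_notMem (by simp [hSi])]
end

section
/- Let 𝒮 be an elimination system on R×E. The poset P(𝒮) is graded by ρ(S,F) = n + |supp(S)| − |F|: whenever (S,F) is covered by (T,G) in P(𝒮), one has ρ(T,G) = ρ(S,F) + 1. -/
/-! Statement 1: the poset `P(𝒮)` is graded by `ρ(S,F) = n + |supp S| - |F|`:
whenever `(S,F)` is covered by `(T,G)`, `ρ(T,G) = ρ(S,F) + 1`. -/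

/-- The grading `ρ(S,F) = n + |supp S| - |F|` (as an integer), where `n = |E|`. -/
def rho {R E : Type*} [Fintype R] [Fintype E] (p : (R → SignType) × Finset (R × E)) : ℤ :=
  (Fintype.card E : ℤ) + (suppCard p.1 : ℤ) - (p.2.card : ℤ)

theorem statement1 {R E : Type*} [Fintype R] [Fintype E]
    (𝒮 : Set (Finset (R × E))) (h𝒮 : IsElimSystem 𝒮)
    (p q : (R → SignType) × Finset (R × E)) (hcov : PCovBy 𝒮 p q) :
    rho q = rho p + 1 := by
  classical
  obtain ⟨⟨hpS, hp⟩, ⟨hqS, hq⟩, ⟨h1, h2⟩, hne, hno⟩ := hcov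
  obtain ⟨S, F⟩ := p
  obtain ⟨T, G⟩ := q
  simp only at hpS hp hqS hq h1 h2
  by_cases hST : S = T
  · subst hST
    have hFG : ¬ F ⊆ G := fun h => hne (by rw [Finset.Subset.antisymm h h2])
    obtain ⟨x, hxF, hxG⟩ := Finset.not_subset.mp hFG
    have hsub : G ⊆ F.erase x := fun y hy =>
      Finset.mem_erase.mpr ⟨fun h => hxG (h ▸ hy), h2 hy⟩
    have hG : F.erase x = G := by
      by_contra hc
      refine hno ⟨(S, F.erase x), ⟨?_, ?_⟩, ⟨fun _ _ => rfl, Finset.erase_subset _ _⟩,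
        ⟨fun _ _ => rfl, hsub⟩, ?_, ?_⟩
      · refine h𝒮.E2 _ F hpS (Finset.erase_subset _ _) fun j => ?_
        obtain ⟨i, hi⟩ := h𝒮.E1 G hqS j
        exact ⟨i, hsub hi⟩
      · intro i j hij
        exact hp i j (Finset.mem_of_mem_erase hij)
      · intro h
        have h' : F.erase x = F := congrArg Prod.snd h
        exact Finset.notMem_erase x F (h'.symm ▸ hxF)
      · intro h
        exact hc (congrArg Prod.snd h)
    have hcard := Finset.card_erase_add_one hxF
    rw [hG] at hcard
    simp only [rho]
    omega
  · obtain ⟨i, hi⟩ := Function.ne_iff.mp hST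
    have hSi : S i = 0 := by
      by_contra h
      exact hi (h1 i h)
    have hTi : T i ≠ 0 := fun h => hi (hSi.trans h.symm)
    have hr : (Function.update S i (T i), F) = (T, G) := by
      by_contra hc
      refine hno ⟨(Function.update S i (T i), F), ⟨hpS, ?_⟩, ⟨?_, subset_rfl⟩,
        ⟨?_, h2⟩, ?_, hc⟩
      · intro k j hkj
        have hk := hp k j hkj
        have hki : k ≠ i := fun h => hk (h ▸ hSi)
        simpa [Function.update_of_ne hki] using hk
      · intro k hk
        have hki : k ≠ i := fun h => hk (h ▸ hSi)
        simp [Function.update_of_ne hki]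
      · intro k hk
        by_cases hki : k = i
        · subst hki
          simp
        · simp only [Function.update_of_ne hki] at hk ⊢
          exact h1 k hk
      · intro h
        have h' := congrFun (congrArg Prod.fst h) i
        simp only [Function.update_self] at h'
        exact hi h'.symm
    obtain ⟨hT, hF⟩ := Prod.mk.inj hr
    have hs : suppCard T = suppCard S + 1 := by
      unfold suppCard
      have hins : (Finset.univ.filter fun k => T k ≠ 0)
          = insert i (Finset.univ.filter fun k => S k ≠ 0) := by
        ext k
        by_cases hki : k = i
        · subst hki
          simp [hTi]
        · have : T k = S k := by rw [← hT, Function.update_of_ne hki]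
          simp [hki, this]
      rw [hins, Finset.card_insert_of_notMem (by simp [hSi])]
    simp only [rho]
    rw [hs, hF]
    push_cast
    ring
end

section
/- Let 𝒮 be an elimination system on R×E. If (S,F) and (T,G) in P(𝒮) have a common lower bound in P(𝒮), then (S∩T, F∪G) belongs to P(𝒮) and is a greatest lower bound of (S,F) and (T,G) in P(𝒮). Consequently, the poset P(𝒮) with a new minimum and a new maximum adjoined is a lattice. -/
/-! Statement 2: if `(S,F)` and `(T,G)` have a common lower bound in `P(𝒮)`, then
`(S∩T, F∪G)` belongs to `P(𝒮)` and is a greatest lower bound of them.  Consequently,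
`P(𝒮)` with a new minimum and maximum adjoined is a lattice. -/

/-- The intersection of two sign vectors. -/
def SVInter {R : Type*} (S T : R → SignType) : R → SignType :=
  fun i => if S i = T i then S i else 0

/-- A poset `P` augmented by a new bottom and top element. -/
inductive Aug (α : Type*) where
  | bot : Aug α
  | top : Aug α
  | of : α → Aug α

/-- Extension of a relation `le` to the augmented poset. -/
def AugLe {α : Type*} (le : α → α → Prop) : Aug α → Aug α → Prop
  | .bot, _ => True
  | _, .top => True
  | .of a, .of b => le a b
  | _, _ => False

/-- The underlying set of the augmented poset `L(P(𝒮))`. -/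
def AugSet {R E : Type*} (𝒮 : Set (Finset (R × E))) :
    Set (Aug ((R → SignType) × Finset (R × E))) :=
  {x | x = .bot ∨ x = .top ∨ ∃ p, memP 𝒮 p ∧ x = .of p}

/-- `g` is a greatest lower bound of `a` and `b` within `D` with respect to `le`. -/
def IsGLBIn {β : Type*} (le : β → β → Prop) (D : Set β) (a b g : β) : Prop :=
  g ∈ D ∧ le g a ∧ le g b ∧ ∀ l ∈ D, le l a → le l b → le l g

/-- `u` is a least upper bound of `a` and `b` within `D` with respect to `le`. -/
def IsLUBIn {β : Type*} (le : β → β → Prop) (D : Set β) (a b u : β) : Prop :=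
  u ∈ D ∧ le a u ∧ le b u ∧ ∀ v ∈ D, le a v → le b v → le u v

theorem PLe_refl' {R E : Type*} (p : (R → SignType) × Finset (R × E)) : PLe p p :=
  ⟨fun _ _ => rfl, fun _ h => h⟩

theorem meet_aux {R E : Type*} [DecidableEq R] [DecidableEq E]
    (𝒮 : Set (Finset (R × E))) (h𝒮 : IsElimSystem 𝒮)
    (p q : (R → SignType) × Finset (R × E)) (hp : memP 𝒮 p)
    (hl : ∃ l, memP 𝒮 l ∧ PLe l p ∧ PLe l q) :
      memP 𝒮 (SVInter p.1 q.1, p.2 ∪ q.2) ∧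
      PLe (SVInter p.1 q.1, p.2 ∪ q.2) p ∧ PLe (SVInter p.1 q.1, p.2 ∪ q.2) q ∧
      ∀ l, memP 𝒮 l → PLe l p → PLe l q → PLe l (SVInter p.1 q.1, p.2 ∪ q.2) := by
  obtain ⟨l, hl, hlp, hlq⟩ := hl
  have hsub : p.2 ∪ q.2 ⊆ l.2 := Finset.union_subset hlp.2 hlq.2
  refine ⟨⟨?_, ?_⟩, ⟨?_, Finset.subset_union_left⟩, ⟨?_, Finset.subset_union_right⟩, ?_⟩
  · refine h𝒮.E2 _ _ hl.1 hsub fun j => ?_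
    obtain ⟨i, hi⟩ := h𝒮.E1 _ hp.1 j
    exact ⟨i, Finset.mem_union_left _ hi⟩
  · intro i j hij
    have h0 := hl.2 i j (hsub hij)
    have h1 := hlp.1 i h0
    have h2 := hlq.1 i h0
    simp only [SVInter]
    rw [← h1, ← h2, if_pos rfl]
    exact h0
  · intro i
    simp only [SVInter]
    split_ifs <;> simp_all
  · intro i
    simp only [SVInter]
    split_ifs <;> simp_all
  · intro m _ hmp hmq
    refine ⟨fun i hi => ?_, Finset.union_subset hmp.2 hmq.2⟩
    have h1 := hmp.1 i hi
    have h2 := hmq.1 i hi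
    simp only [SVInter]
    rw [← h1, ← h2, if_pos rfl]

theorem join_aux {R E : Type*} [DecidableEq R] [DecidableEq E]
    (𝒮 : Set (Finset (R × E))) (h𝒮 : IsElimSystem 𝒮)
    (p q : (R → SignType) × Finset (R × E)) (hp : memP 𝒮 p)
    (hl : ∃ l, memP 𝒮 l ∧ PLe p l ∧ PLe q l) :
    ∃ u, memP 𝒮 u ∧ PLe p u ∧ PLe q u ∧ ∀ l, memP 𝒮 l → PLe p l → PLe q l → PLe u l := by
  obtain ⟨l, hl, hlp, hlq⟩ := hl
  have hsub : l.2 ⊆ p.2 ∩ q.2 := Finset.subset_inter hlp.2 hlq.2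
  refine ⟨(fun i => if p.1 i = 0 then q.1 i else p.1 i, p.2 ∩ q.2), ⟨?_, ?_⟩,
    ⟨?_, Finset.inter_subset_left⟩, ⟨?_, Finset.inter_subset_right⟩, ?_⟩
  · refine h𝒮.E2 _ _ hp.1 Finset.inter_subset_left fun j => ?_
    obtain ⟨i, hi⟩ := h𝒮.E1 _ hl.1 j
    exact ⟨i, hsub hi⟩
  · intro i j hij
    have h0 := hp.2 i j (Finset.mem_inter.1 hij).1
    simp [h0]
  · intro i hi
    simp [hi]
  · intro i hi
    have h2 := hlq.1 i hi
    by_cases h : p.1 i = 0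
    · simp [h]
    · have h1 := hlp.1 i h
      simp [h, h1, h2]
  · intro m _ hmp hmq
    refine ⟨fun i hi => ?_, Finset.subset_inter hmp.2 hmq.2⟩
    by_cases h : p.1 i = 0
    · simp only [h, if_true] at hi ⊢
      exact hmq.1 i hi
    · simp only [h, if_false] at hi ⊢
      exact hmp.1 i hi

theorem AugLe_refl' {R E : Type*} (a : Aug ((R → SignType) × Finset (R × E))) :
    AugLe PLe a a := by
  cases a <;> simp [AugLe, PLe_refl']

theorem AugLe_bot' {R E : Type*} (a : Aug ((R → SignType) × Finset (R × E))) :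
    AugLe PLe .bot a := by
  cases a <;> simp [AugLe]

theorem AugLe_top' {R E : Type*} (a : Aug ((R → SignType) × Finset (R × E))) :
    AugLe PLe a .top := by
  cases a <;> simp [AugLe]

theorem statement2 {R E : Type*} [Fintype R] [Fintype E] [DecidableEq R] [DecidableEq E]
    (𝒮 : Set (Finset (R × E))) (h𝒮 : IsElimSystem 𝒮) :
    (∀ p q : (R → SignType) × Finset (R × E), memP 𝒮 p → memP 𝒮 q →
      (∃ l, memP 𝒮 l ∧ PLe l p ∧ PLe l q) →
      memP 𝒮 (SVInter p.1 q.1, p.2 ∪ q.2) ∧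
      PLe (SVInter p.1 q.1, p.2 ∪ q.2) p ∧ PLe (SVInter p.1 q.1, p.2 ∪ q.2) q ∧
      ∀ l, memP 𝒮 l → PLe l p → PLe l q → PLe l (SVInter p.1 q.1, p.2 ∪ q.2)) ∧
    (∀ a ∈ AugSet 𝒮, ∀ b ∈ AugSet 𝒮,
      (∃ g, IsGLBIn (AugLe PLe) (AugSet 𝒮) a b g) ∧
      (∃ u, IsLUBIn (AugLe PLe) (AugSet 𝒮) a b u)) := by
  refine ⟨fun p q hp _ hl => meet_aux 𝒮 h𝒮 p q hp hl, ?_⟩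
  have hbot : Aug.bot ∈ AugSet 𝒮 := Or.inl rfl
  have htop : Aug.top ∈ AugSet 𝒮 := Or.inr (Or.inl rfl)
  intro a ha b hb
  rcases id ha with rfl | rfl | ⟨p, hp, rfl⟩
  · exact ⟨⟨.bot, hbot, AugLe_refl' _, AugLe_bot' _, fun l _ h _ => h⟩,
      ⟨b, hb, AugLe_bot' _, AugLe_refl' _, fun l _ _ h => h⟩⟩
  · exact ⟨⟨b, hb, AugLe_top' _, AugLe_refl' _, fun l _ _ h => h⟩,
      ⟨.top, htop, AugLe_refl' _, AugLe_top' _, fun l _ h _ => h⟩⟩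
  rcases id hb with rfl | rfl | ⟨q, hq, rfl⟩
  · exact ⟨⟨.bot, hbot, AugLe_bot' _, AugLe_refl' _, fun l _ _ h => h⟩,
      ⟨_, ha, AugLe_refl' _, AugLe_bot' _, fun l _ h _ => h⟩⟩
  · exact ⟨⟨_, ha, AugLe_refl' _, AugLe_top' _, fun l _ h _ => h⟩,
      ⟨.top, htop, AugLe_top' _, AugLe_refl' _, fun l _ _ h => h⟩⟩
  constructor
  · by_cases hl : ∃ l, memP 𝒮 l ∧ PLe l p ∧ PLe l q
    · obtain ⟨h1, h2, h3, h4⟩ := meet_aux 𝒮 h𝒮 p q hp hl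
      refine ⟨.of _, Or.inr (Or.inr ⟨_, h1, rfl⟩), h2, h3, ?_⟩
      rintro l (rfl | rfl | ⟨m, hm, rfl⟩) ha hb
      · exact AugLe_bot' _
      · exact ha.elim
      · exact h4 m hm ha hb
    · refine ⟨.bot, hbot, AugLe_bot' _, AugLe_bot' _, ?_⟩
      rintro l (rfl | rfl | ⟨m, hm, rfl⟩) ha hb
      · exact AugLe_bot' _
      · exact ha.elim
      · exact (hl ⟨m, hm, ha, hb⟩).elim
  · by_cases hl : ∃ l, memP 𝒮 l ∧ PLe p l ∧ PLe q l
    · obtain ⟨u, h1, h2, h3, h4⟩ := join_aux 𝒮 h𝒮 p q hp hl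
      refine ⟨.of u, Or.inr (Or.inr ⟨_, h1, rfl⟩), h2, h3, ?_⟩
      rintro l (rfl | rfl | ⟨m, hm, rfl⟩) ha hb
      · exact ha.elim
      · exact AugLe_top' _
      · exact h4 m hm ha hb
    · refine ⟨.top, htop, AugLe_top' _, AugLe_top' _, ?_⟩
      rintro l (rfl | rfl | ⟨m, hm, rfl⟩) ha hb
      · exact ha.elim
      · exact AugLe_top' _
      · exact (hl ⟨m, hm, ha, hb⟩).elim
end

section
/- Let 𝒮 be an elimination system on R×E, A ∈ {-1,+1}^{R×E}, and Π a partition of R×E refining the partition into columns. The equivalence relation ∼_A is P(𝒮)-homogeneous: whenever (S,F) ≤ (T,G) in P(𝒮) and u ∈ P(𝒮) satisfies u ∼_A (S,F), there exists v ∈ P(𝒮) with v ∼_A (T,G) and u ≤ v. -/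
/-- The sign matrix `SA_F`: `(SA_F)_{ij} = S i * A i j` if `(i,j) ∈ F`, and `0` otherwise,
viewed as a function on `R × E`. -/
def SA {R E : Type*} [DecidableEq R] [DecidableEq E] (A : R → E → SignType) (S : R → SignType) (F : Finset (R × E)) :
    R × E → SignType :=
  fun x => if x ∈ F then S x.1 * A x.1 x.2 else 0

/-- `Pa` is a partition of `R × E` each part of which is contained in a column `R × {j}`. -/
def IsColPartition {R E : Type*} (Pa : Finset (Finset (R × E))) : Prop :=
  (∀ π ∈ Pa, π.Nonempty) ∧ (∀ x : R × E, ∃! π, π ∈ Pa ∧ x ∈ π) ∧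
    (∀ π ∈ Pa, ∀ x ∈ π, ∀ y ∈ π, x.2 = y.2)

/-- `X ∼ Y` with respect to the partition `Pa`: for every part `π` and nonzero sign `s`,
`π` contains a position where `X` equals `s` iff it contains one where `Y` equals `s`. -/
def MatSim {R E : Type*} (Pa : Finset (Finset (R × E))) (X Y : R × E → SignType) : Prop :=
  ∀ π ∈ Pa, ∀ s : SignType, s ≠ 0 → ((∃ x ∈ π, X x = s) ↔ (∃ x ∈ π, Y x = s))

/-- The equivalence relation `∼_A` on `P(𝒮)`: `(S,F) ∼_A (T,G)` iff `S = T` and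
`SA_F ∼ SA_G`. -/
def SimA {R E : Type*} [DecidableEq R] [DecidableEq E] (A : R → E → SignType) (Pa : Finset (Finset (R × E)))
    (p q : (R → SignType) × Finset (R × E)) : Prop :=
  p.1 = q.1 ∧ MatSim Pa (SA A p.1 p.2) (SA A q.1 q.2)

/-- The order of a quotient of `P(𝒮)` by an equivalence relation `r`, expressed on
representatives: `[p] ≤ [q]` iff `u ≤ v` for some `u ∈ [p]`, `v ∈ [q]`. -/
def QLeR {R E : Type*} (𝒮 : Set (Finset (R × E)))
    (r : ((R → SignType) × Finset (R × E)) → ((R → SignType) × Finset (R × E)) → Prop)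
    (p q : (R → SignType) × Finset (R × E)) : Prop :=
  ∃ u v, memP 𝒮 u ∧ memP 𝒮 v ∧ r u p ∧ r v q ∧ PLe u v

/-- The covering relation of the quotient of `P(𝒮)` by `r`, on representatives:
`[q]` covers `[p]`. -/
def QCovByR {R E : Type*} (𝒮 : Set (Finset (R × E)))
    (r : ((R → SignType) × Finset (R × E)) → ((R → SignType) × Finset (R × E)) → Prop)
    (p q : (R → SignType) × Finset (R × E)) : Prop :=
  memP 𝒮 p ∧ memP 𝒮 q ∧ QLeR 𝒮 r p q ∧ ¬ r p q ∧
    ¬ ∃ x, memP 𝒮 x ∧ QLeR 𝒮 r p x ∧ QLeR 𝒮 r x q ∧ ¬ r x p ∧ ¬ r x q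

/-! Statement 3: the equivalence relation `∼_A` is `P(𝒮)`-homogeneous. -/

theorem statement3 {R E : Type*} [Fintype R] [Fintype E] [DecidableEq R] [DecidableEq E]
    (𝒮 : Set (Finset (R × E))) (h𝒮 : IsElimSystem 𝒮)
    (A : R → E → SignType) (hA : ∀ i j, A i j ≠ 0)
    (Pa : Finset (Finset (R × E))) (hPa : IsColPartition Pa)
    (p q u : (R → SignType) × Finset (R × E))
    (hp : memP 𝒮 p) (hq : memP 𝒮 q) (hu : memP 𝒮 u)
    (hle : PLe p q) (husim : SimA A Pa u p) :
    ∃ v, memP 𝒮 v ∧ SimA A Pa v q ∧ PLe u v := by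
  classical
  obtain ⟨S, F⟩ := p
  obtain ⟨T, G⟩ := q
  obtain ⟨S₁, U⟩ := u
  obtain ⟨hS, hsim⟩ := husim
  obtain ⟨hST, hGF⟩ := hle
  obtain ⟨hU, hUs⟩ := hu
  obtain ⟨hG, hGs⟩ := hq
  obtain ⟨hF, hFs⟩ := hp
  obtain ⟨hne, hex, hcol⟩ := hPa
  dsimp only at *
  subst hS
  let H : Finset (R × E) := U.filter fun x =>
    ∃ π ∈ Pa, x ∈ π ∧ ∃ y ∈ π, y ∈ G ∧ T y.1 * A y.1 y.2 = T x.1 * A x.1 x.2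
  have hUT : ∀ x ∈ U, S₁ x.1 = T x.1 := fun x hx => hST _ (hUs x.1 x.2 hx)
  have hFT : ∀ x ∈ F, S₁ x.1 = T x.1 := fun x hx => hST _ (hFs x.1 x.2 hx)
  have hHU : H ⊆ U := Finset.filter_subset _ _
  have key : ∀ π ∈ Pa, ∀ y ∈ π, y ∈ G →
      ∃ x ∈ π, x ∈ H ∧ T x.1 * A x.1 x.2 = T y.1 * A y.1 y.2 := by
    intro π hπ y hy hyG
    have hyF := hGF hyG
    have h0 : T y.1 * A y.1 y.2 ≠ 0 := mul_ne_zero (hGs y.1 y.2 hyG) (hA _ _)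
    obtain ⟨x, hx, hxe⟩ := (hsim π hπ _ h0).2 ⟨y, hy, by simp [SA, hyF, hFT y hyF]⟩
    by_cases hxU : x ∈ U
    · simp only [SA, hxU, if_true, hUT x hxU] at hxe
      exact ⟨x, hx, Finset.mem_filter.2 ⟨hxU, π, hπ, hx, y, hy, hyG, hxe.symm⟩, hxe⟩
    · simp only [SA, hxU, if_false] at hxe
      exact absurd hxe.symm h0
  have hHs : ∀ i j, (i, j) ∈ H → T i ≠ 0 := by
    intro i j h
    rw [← hUT (i, j) (hHU h)]
    exact hUs i j (hHU h)
  refine ⟨(T, H), ⟨?_, hHs⟩, ⟨rfl, ?_⟩, hST, hHU⟩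
  · refine h𝒮.E2 H U hU hHU fun j => ?_
    obtain ⟨i, hi⟩ := h𝒮.E1 G hG j
    obtain ⟨π, ⟨hπ, hm⟩, -⟩ := hex (i, j)
    obtain ⟨x, hx, hxH, -⟩ := key π hπ _ hm hi
    have hc : x.2 = j := hcol π hπ x hx _ hm
    exact ⟨x.1, by rw [← hc]; exact hxH⟩
  · intro π hπ s hs
    constructor
    · rintro ⟨x, hx, hxe⟩
      by_cases hxH : x ∈ H
      · simp only [SA, hxH, if_true] at hxe
        obtain ⟨-, π₁, hπ₁, hx₁, y, hy, hyG, hye⟩ := Finset.mem_filter.1 hxH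
        have : π₁ = π := (hex x).unique ⟨hπ₁, hx₁⟩ ⟨hπ, hx⟩
        subst this
        exact ⟨y, hy, by simp only [SA, hyG, if_true, hye, hxe]⟩
      · simp only [SA, hxH, if_false] at hxe
        exact absurd hxe.symm hs
    · rintro ⟨y, hy, hye⟩
      by_cases hyG : y ∈ G
      · simp only [SA, hyG, if_true] at hye
        obtain ⟨x, hx, hxH, hxe⟩ := key π hπ y hy hyG
        exact ⟨x, hx, by simp only [SA, hxH, if_true, hye, hxe]⟩
      · simp only [SA, hyG, if_false] at hye
        exact absurd hye.symm hs
end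

section
/- Let 𝒮 be an elimination system on R×E, A ∈ {-1,+1}^{R×E}, and Π a partition of R×E refining the partition into columns. An element (S,F) ∈ P(𝒮) is a maximal element of its ∼_A-equivalence class (with respect to the order of P(𝒮)) if and only if for every part π ∈ Π and every s ∈ {+1,-1}, at most one entry of SA_F lying in π equals s. -/
/-! Statement 4: `(S,F) ∈ P(𝒮)` is a maximal element of its `∼_A`-equivalence class iff
for every part `π ∈ Π` and every nonzero sign `s`, at most one entry of `SA_F` lying in `π`
equals `s`. -/

theorem statement4 {R E : Type*} [Fintype R] [Fintype E] [DecidableEq R] [DecidableEq E]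
    (𝒮 : Set (Finset (R × E))) (h𝒮 : IsElimSystem 𝒮)
    (A : R → E → SignType) (hA : ∀ i j, A i j ≠ 0)
    (Pa : Finset (Finset (R × E))) (hPa : IsColPartition Pa)
    (p : (R → SignType) × Finset (R × E)) (hp : memP 𝒮 p) :
    (∀ q, memP 𝒮 q → SimA A Pa q p → PLe p q → q = p) ↔
      (∀ π ∈ Pa, ∀ s : SignType, s ≠ 0 →
        ∀ x ∈ π, ∀ y ∈ π, SA A p.1 p.2 x = s → SA A p.1 p.2 y = s → x = y) := by
  obtain ⟨S, F⟩ := p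
  obtain ⟨hF, hS⟩ := hp
  obtain ⟨-, hP2, hP3⟩ := hPa
  simp only at hF hS
  constructor
  · intro h π hπ s hs x hx y hy hxs hys
    simp only at hxs hys
    by_contra hxy
    have hxF : x ∈ F := by
      by_contra hn
      exact hs (by simpa [SA, hn] using hxs.symm)
    have hyF : y ∈ F := by
      by_contra hn
      exact hs (by simpa [SA, hn] using hys.symm)
    have hcol := hP3 π hπ x hx y hy
    have hmem : F.erase y ∈ 𝒮 := by
      refine h𝒮.E2 _ F hF (Finset.erase_subset _ _) ?_
      intro j
      obtain ⟨i, hi⟩ := h𝒮.E1 F hF j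
      by_cases hij : (i, j) = y
      · have hj : x.2 = j := by rw [hcol, ← hij]
        refine ⟨x.1, Finset.mem_erase.2 ⟨?_, ?_⟩⟩
        · rw [← hj]; exact hxy
        · rw [← hj]; exact hxF
      · exact ⟨i, Finset.mem_erase.2 ⟨hij, hi⟩⟩
    have hne : ∀ z, z ≠ y → SA A S (F.erase y) z = SA A S F z := by
      intro z hz
      simp [SA, Finset.mem_erase, hz]
    have hq := h (S, F.erase y)
      ⟨hmem, fun i j hij => hS i j (Finset.mem_of_mem_erase hij)⟩
      ⟨rfl, by
        intro π' hπ' s' hs'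
        simp only
        constructor
        · rintro ⟨z, hz, hzs⟩
          have hzy : z ≠ y := by
            rintro rfl
            exact hs' (by simpa [SA] using hzs.symm)
          exact ⟨z, hz, by rw [← hne z hzy]; exact hzs⟩
        · rintro ⟨z, hz, hzs⟩
          by_cases hzy : z = y
          · subst hzy
            have hpp : π' = π := (hP2 z).unique ⟨hπ', hz⟩ ⟨hπ, hy⟩
            subst hpp
            exact ⟨x, hx, by rw [hne x hxy, hxs, ← hys, hzs]⟩
          · exact ⟨z, hz, by rw [hne z hzy]; exact hzs⟩⟩
      ⟨fun _ _ => rfl, Finset.erase_subset _ _⟩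
    have hE : F.erase y = F := congrArg Prod.snd hq
    exact Finset.notMem_erase y F (by rw [hE]; exact hyF)
  · rintro h ⟨T, G⟩ hq ⟨hT, hsim⟩ ⟨-, hGF⟩
    simp only at hT hsim hGF h
    subst hT
    have hFG : F ⊆ G := by
      intro z hz
      obtain ⟨π, ⟨hπ, hzπ⟩, -⟩ := hP2 z
      have hs : SA A T F z ≠ 0 := by
        have h1 : T z.1 ≠ 0 := hS z.1 z.2 hz
        simp only [SA, hz, if_true]
        exact mul_ne_zero h1 (hA _ _)
      obtain ⟨w, hw, hws⟩ := (hsim π hπ _ hs).2 ⟨z, hzπ, rfl⟩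
      have hwG : w ∈ G := by
        by_contra hn
        exact hs (by simpa [SA, hn] using hws.symm)
      have hwF : SA A T F w = SA A T F z := by
        rw [← hws]; simp [SA, hwG, hGF hwG]
      have := h π hπ _ hs w hw z hzπ hwF rfl
      rwa [← this]
    rw [Finset.Subset.antisymm hGF hFG]
end

section
/- Let 𝒮 be an elimination system on R×E, A ∈ {-1,+1}^{R×E}, and Π a partition of R×E refining the partition into columns. The quotient poset P(𝒮)/∼_A is graded by ρ([(S,F)]) = n + |supp(S)| − m(S,F), where m(S,F) is the number of pairs (π,s) ∈ Π×{+1,-1} such that some entry of SA_F lying in π equals s: the value ρ is constant on each ∼_A-equivalence class, and whenever [(S,F)] is covered by [(T,G)] in P(𝒮)/∼_A, one has ρ([(T,G)]) = ρ([(S,F)]) + 1. -/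
/-! Statement 5: the quotient poset `P(𝒮)/∼_A` is graded by
`ρ([(S,F)]) = n + |supp S| - m(S,F)`, where `m(S,F)` counts the pairs `(π,s)` such that
some entry of `SA_F` lying in `π` equals `s ∈ {+1,-1}`. -/

/-- `m(S,F)`: the number of pairs `(π, s) ∈ Π × {+1,-1}` such that some entry of `SA_F`
lying in `π` equals `s`. -/
noncomputable def mval {R E : Type*} [Fintype R] [Fintype E] [DecidableEq R] [DecidableEq E]
    (A : R → E → SignType) (Pa : Finset (Finset (R × E)))
    (p : (R → SignType) × Finset (R × E)) : ℕ :=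
  Set.ncard {c : Finset (R × E) × SignType |
    c.1 ∈ Pa ∧ c.2 ≠ 0 ∧ ∃ x ∈ c.1, SA A p.1 p.2 x = c.2}

/-- The grading `ρ([(S,F)]) = n + |supp S| - m(S,F)` (as an integer). -/
noncomputable def rhoQ {R E : Type*} [Fintype R] [Fintype E] [DecidableEq R] [DecidableEq E]
    (A : R → E → SignType) (Pa : Finset (Finset (R × E)))
    (p : (R → SignType) × Finset (R × E)) : ℤ :=
  (Fintype.card E : ℤ) + (suppCard p.1 : ℤ) - (mval A Pa p : ℤ)

section helpers
variable {R E : Type*} [DecidableEq R] [DecidableEq E]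

/-- The set of pairs counted by `mval`. -/
def MSet (A : R → E → SignType) (Pa : Finset (Finset (R × E)))
    (p : (R → SignType) × Finset (R × E)) : Set (Finset (R × E) × SignType) :=
  {c | c.1 ∈ Pa ∧ c.2 ≠ 0 ∧ ∃ x ∈ c.1, SA A p.1 p.2 x = c.2}

theorem SimA_iff (A : R → E → SignType) (Pa : Finset (Finset (R × E)))
    (p q : (R → SignType) × Finset (R × E)) :
    SimA A Pa p q ↔ p.1 = q.1 ∧ MSet A Pa p = MSet A Pa q := by
  unfold SimA MatSim MSet
  refine and_congr_right fun _ => ⟨fun h => ?_, fun h π hπ s hs => ?_⟩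
  · ext ⟨π, s⟩
    simp only [Set.mem_setOf_eq]
    exact and_congr_right fun hπ => and_congr_right fun hs => h π hπ s hs
  · have := Set.ext_iff.1 h (π, s)
    simpa [hπ, hs] using this

theorem SA_mem {A : R → E → SignType} {S : R → SignType} {F : Finset (R × E)} {x : R × E}
    (h : SA A S F x ≠ 0) : x ∈ F := by
  by_contra hx
  exact h (if_neg hx)

theorem SA_congr {A : R → E → SignType} {S T : R → SignType} {F G : Finset (R × E)} {x : R × E}
    (hF : x ∈ F) (hG : x ∈ G) (h : S x.1 = T x.1) : SA A S F x = SA A T G x := by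
  simp [SA, hF, hG, h]

theorem MSet_mono (A : R → E → SignType) (Pa : Finset (Finset (R × E)))
    (S : R → SignType) {F G : Finset (R × E)} (h : G ⊆ F) :
    MSet A Pa (S, G) ⊆ MSet A Pa (S, F) := by
  rintro ⟨π, s⟩ ⟨hπ, hs, x, hx, hv⟩
  simp only at hπ hs hx hv
  have hxG : x ∈ G := SA_mem (hv.symm ▸ hs)
  exact ⟨hπ, hs, x, hx, (SA_congr (h hxG) hxG rfl).trans hv⟩

theorem rho_step [Fintype R] [Fintype E]
    (𝒮 : Set (Finset (R × E))) (h𝒮 : IsElimSystem 𝒮)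
    (A : R → E → SignType)
    (Pa : Finset (Finset (R × E))) (hPa : IsColPartition Pa)
    (p q : (R → SignType) × Finset (R × E)) (hp : memP 𝒮 p) (hq : memP 𝒮 q) (hpq : PLe p q)
    (hne : ¬ SimA A Pa p q)
    (hcov : ∀ x, memP 𝒮 x → PLe p x → PLe x q → SimA A Pa x p ∨ SimA A Pa x q) :
    rhoQ A Pa q = rhoQ A Pa p + 1 := by
  obtain ⟨S, F⟩ := p
  obtain ⟨T, G⟩ := q
  obtain ⟨hST, hGF⟩ := hpq
  simp only at hST hGF
  have hm : ∀ p, mval A Pa p = (MSet A Pa p).ncard := fun _ => rfl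
  by_cases hEq : S = T
  · subst hEq
    have hex : ∃ c ∈ MSet A Pa (S, F), c ∉ MSet A Pa (S, G) := by
      by_contra! h
      exact hne ((SimA_iff ..).2 ⟨rfl, Set.Subset.antisymm h (MSet_mono A Pa S hGF)⟩)
    obtain ⟨⟨π, s⟩, hc, hc'⟩ := hex
    have hcc := hc
    obtain ⟨hπ, hs, -⟩ := hcc
    simp only at hπ hs
    classical
    set F' := F.filter (fun y => ¬ (y ∈ π ∧ SA A S F y = s)) with hF'
    have hF'F : F' ⊆ F := Finset.filter_subset _ _
    have hGF' : G ⊆ F' := by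
      intro y hy
      refine Finset.mem_filter.2 ⟨hGF hy, fun h => hc' ⟨hπ, hs, y, h.1, ?_⟩⟩
      exact (SA_congr hy (hGF hy) rfl).trans h.2
    have hnot : (π, s) ∉ MSet A Pa (S, F') := by
      rintro ⟨-, -, y, hy, hv⟩
      simp only at hy hv
      have hyF : y ∈ F' := SA_mem (hv.symm ▸ hs)
      exact (Finset.mem_filter.1 hyF).2 ⟨hy, (SA_congr (hF'F hyF) hyF rfl).trans hv⟩
    have hins : MSet A Pa (S, F) = insert (π, s) (MSet A Pa (S, F')) := by
      apply Set.Subset.antisymm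
      · rintro ⟨π', s'⟩ ⟨h1, h2, y, hy, hv⟩
        simp only at h1 h2 hy hv
        have hyF : y ∈ F := SA_mem (hv.symm ▸ h2)
        by_cases hyF' : y ∈ F'
        · exact Or.inr ⟨h1, h2, y, hy, (SA_congr hyF' hyF rfl).trans hv⟩
        · left
          have h3 : y ∈ π ∧ SA A S F y = s := by
            by_contra h3
            exact hyF' (Finset.mem_filter.2 ⟨hyF, h3⟩)
          have h4 : π' = π := (hPa.2.1 y).unique ⟨h1, hy⟩ ⟨hπ, h3.1⟩
          rw [h4, ← hv, h3.2]
      · exact Set.insert_subset hc (MSet_mono A Pa S hF'F)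
    have hmem : memP 𝒮 (S, F') := by
      refine ⟨h𝒮.E2 F' F hp.1 hF'F fun j => ?_, fun i j h => hp.2 i j (hF'F h)⟩
      obtain ⟨i, hi⟩ := h𝒮.E1 G hq.1 j
      exact ⟨i, hGF' hi⟩
    rcases hcov (S, F') hmem ⟨fun _ _ => rfl, hF'F⟩ ⟨fun _ _ => rfl, hGF'⟩ with h | h
    · exact absurd (((SimA_iff ..).1 h).2 ▸ hc) hnot
    · have h1 := ((SimA_iff ..).1 h).2
      have h2 : mval A Pa (S, F) = mval A Pa (S, G) + 1 := by
        rw [hm, hm, hins, Set.ncard_insert_of_notMem hnot (Set.toFinite _), h1]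
      simp only [rhoQ, h2]
      push_cast
      ring
  · have hSG : ∀ i j, (i, j) ∈ G → S i ≠ 0 := fun i j h => hp.2 i j (hGF h)
    have h1 : SimA A Pa (S, G) (S, F) := by
      rcases hcov (S, G) ⟨hq.1, hSG⟩ ⟨fun _ _ => rfl, hGF⟩ ⟨hST, Finset.Subset.refl _⟩ with h | h
      · exact h
      · exact absurd h.1 hEq
    have hM : MSet A Pa (T, G) = MSet A Pa (S, G) := by
      have : SA A T G = SA A S G := by
        funext y
        by_cases hy : y ∈ G
        · exact SA_congr hy hy (hST y.1 (hSG y.1 y.2 hy)).symm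
        · simp [SA, hy]
      simp only [MSet, this]
    obtain ⟨a, ha⟩ : ∃ a, S a ≠ T a := Function.ne_iff.1 hEq
    have hSa : S a = 0 := by
      by_contra h
      exact ha (hST a h)
    have hTa : T a ≠ 0 := fun h => ha (hSa.trans h.symm)
    have hupd : Function.update S a (T a) = T := by
      have hle1 : SVLe S (Function.update S a (T a)) := by
        intro i hi
        have : i ≠ a := fun h => hi (h ▸ hSa)
        simp [this]
      have hle2 : SVLe (Function.update S a (T a)) T := by
        intro i hi
        by_cases h : i = a
        · subst h; simp
        · simp only [Function.update_of_ne h] at hi ⊢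
          exact hST i hi
      have hmem : memP 𝒮 (Function.update S a (T a), G) :=
        ⟨hq.1, fun i j h => by
          have h0 := hSG i j h
          have h1 := hle1 i h0
          exact fun hz => h0 (h1.trans hz)⟩
      rcases hcov _ hmem ⟨hle1, hGF⟩ ⟨hle2, Finset.Subset.refl _⟩ with h | h
      · have := congrFun h.1 a
        simp only [Function.update_self] at this
        exact absurd this.symm ha
      · exact h.1
    have hcard : suppCard T = suppCard S + 1 := by
      unfold suppCard
      have : (Finset.univ.filter fun i => T i ≠ 0)
          = insert a (Finset.univ.filter fun i => S i ≠ 0) := by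
        ext i
        simp only [Finset.mem_filter, Finset.mem_univ, true_and, Finset.mem_insert]
        by_cases h : i = a
        · subst h; simp [hTa]
        · rw [← hupd]; simp [h]
      rw [this, Finset.card_insert_of_notMem (by simp [hSa])]
    have h2 : mval A Pa (T, G) = mval A Pa (S, F) := by
      rw [hm, hm, hM, ((SimA_iff ..).1 h1).2]
    simp only [rhoQ, h2, hcard]
    push_cast
    ring

theorem rho_sim [Fintype R] [Fintype E] (A : R → E → SignType)
    (Pa : Finset (Finset (R × E))) (p q : (R → SignType) × Finset (R × E))
    (h : SimA A Pa p q) : rhoQ A Pa p = rhoQ A Pa q := by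
  have h' := (SimA_iff ..).1 h
  have hm : ∀ p, mval A Pa p = (MSet A Pa p).ncard := fun _ => rfl
  simp only [rhoQ, hm, h'.1, h'.2]

end helpers

theorem statement5 {R E : Type*} [Fintype R] [Fintype E] [DecidableEq R] [DecidableEq E]
    (𝒮 : Set (Finset (R × E))) (h𝒮 : IsElimSystem 𝒮)
    (A : R → E → SignType) (hA : ∀ i j, A i j ≠ 0)
    (Pa : Finset (Finset (R × E))) (hPa : IsColPartition Pa) :
    (∀ p q, memP 𝒮 p → memP 𝒮 q → SimA A Pa p q → rhoQ A Pa p = rhoQ A Pa q) ∧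
    (∀ p q, QCovByR 𝒮 (SimA A Pa) p q → rhoQ A Pa q = rhoQ A Pa p + 1) := by
  refine ⟨fun p q _ _ h => rho_sim A Pa p q h, ?_⟩
  rintro p q ⟨-, -, ⟨u, v, hu, hv, hup, hvq, huv⟩, hne, hno⟩
  have symm : ∀ {x y}, SimA A Pa x y → SimA A Pa y x := by
    intro x y h
    rw [SimA_iff] at h ⊢
    exact ⟨h.1.symm, h.2.symm⟩
  have trans : ∀ {x y z}, SimA A Pa x y → SimA A Pa y z → SimA A Pa x z := by
    intro x y z h h'
    rw [SimA_iff] at h h' ⊢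
    exact ⟨h.1.trans h'.1, h.2.trans h'.2⟩
  have rfl' : ∀ x, SimA A Pa x x := fun x => (SimA_iff ..).2 ⟨rfl, rfl⟩
  rw [← rho_sim A Pa u p hup, ← rho_sim A Pa v q hvq]
  refine rho_step 𝒮 h𝒮 A Pa hPa u v hu hv huv (fun h => hne (trans (symm hup) (trans h hvq))) ?_
  intro x hx hux hxv
  by_contra! hcon
  exact hno ⟨x, hx, ⟨u, x, hu, hx, hup, rfl' x, hux⟩, ⟨x, v, hx, hv, rfl' x, hvq, hxv⟩,
    fun h => hcon.1 (trans h (symm hup)), fun h => hcon.2 (trans h (symm hvq))⟩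
end

section
/- Let 𝒮 be an elimination system on R×E, A ∈ {-1,+1}^{R×E}, and Π a partition of R×E refining the partition into columns. If two elements of the quotient poset P(𝒮)/∼_A have a common lower bound in P(𝒮)/∼_A, then they have a greatest lower bound in P(𝒮)/∼_A. Consequently, P(𝒮)/∼_A with a new minimum and a new maximum adjoined is a lattice. -/
/-- The pattern of `p`: the sign `s` occurs in the part `π`. -/
def Pat6 {R E : Type*} [DecidableEq R] [DecidableEq E] (A : R → E → SignType)
    (p : (R → SignType) × Finset (R × E)) (π : Finset (R × E)) (s : SignType) : Prop :=
  ∃ x ∈ π, SA A p.1 p.2 x = s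

theorem pat6_iff {R E : Type*} [DecidableEq R] [DecidableEq E] (A : R → E → SignType)
    (p : (R → SignType) × Finset (R × E)) (π : Finset (R × E)) (s : SignType) (hs : s ≠ 0) :
    Pat6 A p π s ↔ ∃ x ∈ π, x ∈ p.2 ∧ p.1 x.1 * A x.1 x.2 = s := by
  unfold Pat6 SA
  constructor
  · rintro ⟨x, hx, h⟩
    by_cases hm : x ∈ p.2
    · exact ⟨x, hx, hm, by simpa [hm] using h⟩
    · simp only [hm, if_false] at h
      exact absurd h.symm hs
  · rintro ⟨x, hx, hm, h⟩
    exact ⟨x, hx, by simpa [hm] using h⟩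

theorem restrict6 {R E : Type*} [DecidableEq R] [DecidableEq E]
    (𝒮 : Set (Finset (R × E))) (h𝒮 : IsElimSystem 𝒮) (A : R → E → SignType)
    (Pa : Finset (Finset (R × E))) (hPa : IsColPartition Pa)
    (l : (R → SignType) × Finset (R × E)) (hl : memP 𝒮 l) (T : R → SignType)
    (hT : SVLe l.1 T) (Z : Finset (R × E) → SignType → Prop)
    (hZ : ∀ π ∈ Pa, ∀ s : SignType, s ≠ 0 → Z π s → Pat6 A l π s)
    (hcol : ∀ j : E, ∃ π ∈ Pa, ∃ s : SignType, s ≠ 0 ∧ Z π s ∧ ∀ x ∈ π, x.2 = j) :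
    ∃ G, G ⊆ l.2 ∧ memP 𝒮 (T, G) ∧
      ∀ π ∈ Pa, ∀ s : SignType, s ≠ 0 → (Pat6 A (T, G) π s ↔ Z π s) := by
  classical
  have hlT : ∀ x : R × E, x ∈ l.2 → l.1 x.1 = T x.1 := fun x hx => hT _ (hl.2 x.1 x.2 hx)
  let G := l.2.filter (fun x => ∃ π ∈ Pa, x ∈ π ∧ Z π (T x.1 * A x.1 x.2))
  have hG : G ⊆ l.2 := Finset.filter_subset _ _
  have key : ∀ π ∈ Pa, ∀ s : SignType, s ≠ 0 → Z π s →
      ∃ x ∈ π, x ∈ G ∧ T x.1 * A x.1 x.2 = s := by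
    intro π hπ s hs hz
    obtain ⟨x, hx, hm, h⟩ := (pat6_iff A l π s hs).1 (hZ π hπ s hs hz)
    rw [hlT x hm] at h
    exact ⟨x, hx, Finset.mem_filter.2 ⟨hm, π, hπ, hx, h ▸ hz⟩, h⟩
  refine ⟨G, hG, ⟨?_, ?_⟩, ?_⟩
  · refine h𝒮.E2 G l.2 hl.1 hG fun j => ?_
    obtain ⟨π, hπ, s, hs, hz, hj⟩ := hcol j
    obtain ⟨x, hx, hm, -⟩ := key π hπ s hs hz
    refine ⟨x.1, ?_⟩
    rw [← hj x hx]
    exact hm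
  · intro i j hij
    have := hG hij
    show T i ≠ 0
    rw [← hlT _ this]
    exact hl.2 i j this
  · intro π hπ s hs
    rw [pat6_iff A _ π s hs]
    constructor
    · rintro ⟨x, hx, hm, h⟩
      obtain ⟨-, π', hπ', hx', hz⟩ := Finset.mem_filter.1 hm
      have : π' = π := (hPa.2.1 x).unique ⟨hπ', hx'⟩ ⟨hπ, hx⟩
      subst this
      rw [← h]
      exact hz
    · exact key π hπ s hs

theorem patcol6 {R E : Type*} [DecidableEq R] [DecidableEq E]
    (𝒮 : Set (Finset (R × E))) (h𝒮 : IsElimSystem 𝒮) (A : R → E → SignType)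
    (hA : ∀ i j, A i j ≠ 0)
    (Pa : Finset (Finset (R × E))) (hPa : IsColPartition Pa)
    (p : (R → SignType) × Finset (R × E)) (hp : memP 𝒮 p) (j : E) :
    ∃ π ∈ Pa, ∃ s : SignType, s ≠ 0 ∧ Pat6 A p π s ∧ ∀ x ∈ π, x.2 = j := by
  obtain ⟨i, hi⟩ := h𝒮.E1 p.2 hp.1 j
  obtain ⟨π, ⟨hπ, hx⟩, -⟩ := hPa.2.1 (i, j)
  have hs : p.1 i * A i j ≠ 0 := mul_ne_zero (hp.2 i j hi) (hA i j)
  exact ⟨π, hπ, _, hs, (pat6_iff A p π _ hs).2 ⟨_, hx, hi, rfl⟩,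
    fun x h => hPa.2.2 π hπ x h _ hx⟩

theorem qle6 {R E : Type*} [DecidableEq R] [DecidableEq E]
    (𝒮 : Set (Finset (R × E))) (h𝒮 : IsElimSystem 𝒮) (A : R → E → SignType)
    (hA : ∀ i j, A i j ≠ 0)
    (Pa : Finset (Finset (R × E))) (hPa : IsColPartition Pa)
    (p q : (R → SignType) × Finset (R × E)) (hp : memP 𝒮 p) (hq : memP 𝒮 q) :
    QLeR 𝒮 (SimA A Pa) p q ↔
      SVLe p.1 q.1 ∧ ∀ π ∈ Pa, ∀ s : SignType, s ≠ 0 → Pat6 A q π s → Pat6 A p π s := by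
  constructor
  · rintro ⟨u, v, hu, hv, ⟨hup, hup'⟩, ⟨hvq, hvq'⟩, hle, hsub⟩
    refine ⟨hup ▸ hvq ▸ hle, fun π hπ s hs h => ?_⟩
    refine (hup' π hπ s hs).1 ?_
    obtain ⟨x, hx, hm, h⟩ := (pat6_iff A v π s hs).1 ((hvq' π hπ s hs).2 h)
    refine (pat6_iff A u π s hs).2 ⟨x, hx, hsub hm, ?_⟩
    rw [hle _ (hu.2 x.1 x.2 (hsub hm))]
    exact h
  · rintro ⟨hle, hpat⟩
    obtain ⟨G, hG, hm, hGZ⟩ := restrict6 𝒮 h𝒮 A Pa hPa p hp q.1 hle (Pat6 A q) hpat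
      (patcol6 𝒮 h𝒮 A hA Pa hPa q hq)
    exact ⟨p, (q.1, G), hp, hm, ⟨rfl, fun _ _ _ _ => Iff.rfl⟩, ⟨rfl, hGZ⟩, hle, hG⟩

theorem glb6 {R E : Type*} [DecidableEq R] [DecidableEq E]
    (𝒮 : Set (Finset (R × E))) (h𝒮 : IsElimSystem 𝒮) (A : R → E → SignType)
    (hA : ∀ i j, A i j ≠ 0)
    (Pa : Finset (Finset (R × E))) (hPa : IsColPartition Pa)
    (p q : (R → SignType) × Finset (R × E)) (hp : memP 𝒮 p) (hq : memP 𝒮 q)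
    (h : ∃ l, memP 𝒮 l ∧ QLeR 𝒮 (SimA A Pa) l p ∧ QLeR 𝒮 (SimA A Pa) l q) :
      ∃ g, memP 𝒮 g ∧ QLeR 𝒮 (SimA A Pa) g p ∧ QLeR 𝒮 (SimA A Pa) g q ∧
        ∀ l, memP 𝒮 l → QLeR 𝒮 (SimA A Pa) l p → QLeR 𝒮 (SimA A Pa) l q →
          QLeR 𝒮 (SimA A Pa) l g := by
  have Q := qle6 𝒮 h𝒮 A hA Pa hPa
  obtain ⟨l, hl, hlp, hlq⟩ := h
  let T : R → SignType := fun i => if p.1 i = q.1 i then p.1 i else 0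
  have hTp : SVLe T p.1 := by
    intro i hi
    simp only [T] at hi ⊢
    split_ifs at hi ⊢ <;> simp_all
  have hTq : SVLe T q.1 := by
    intro i hi
    simp only [T] at hi ⊢
    split_ifs at hi ⊢ <;> simp_all
  have hT : ∀ S, SVLe S p.1 → SVLe S q.1 → SVLe S T := by
    intro S h1 h2 i hi
    have e : p.1 i = q.1 i := (h1 i hi).symm.trans (h2 i hi)
    simp only [T, e, if_true]
    exact h2 i hi
  have hlp' := (Q l p hl hp).1 hlp
  have hlq' := (Q l q hl hq).1 hlq
  obtain ⟨G, -, hm, hGZ⟩ := restrict6 𝒮 h𝒮 A Pa hPa l hl T (hT _ hlp'.1 hlq'.1)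
    (fun π s => Pat6 A p π s ∨ Pat6 A q π s)
    (fun π hπ s hs h => h.elim (hlp'.2 π hπ s hs) (hlq'.2 π hπ s hs))
    (fun j => by
      obtain ⟨π, hπ, s, hs, hz, hj⟩ := patcol6 𝒮 h𝒮 A hA Pa hPa p hp j
      exact ⟨π, hπ, s, hs, Or.inl hz, hj⟩)
  refine ⟨(T, G), hm, (Q _ _ hm hp).2 ⟨hTp, fun π hπ s hs h => (hGZ π hπ s hs).2 (Or.inl h)⟩,
    (Q _ _ hm hq).2 ⟨hTq, fun π hπ s hs h => (hGZ π hπ s hs).2 (Or.inr h)⟩, ?_⟩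
  intro k hk hkp hkq
  have hkp' := (Q k p hk hp).1 hkp
  have hkq' := (Q k q hk hq).1 hkq
  exact (Q _ _ hk hm).2 ⟨hT _ hkp'.1 hkq'.1, fun π hπ s hs h =>
    ((hGZ π hπ s hs).1 h).elim (hkp'.2 π hπ s hs) (hkq'.2 π hπ s hs)⟩

/-- In a finite preorder with conditional meets, conditional joins exist. -/
theorem lub6 {α : Type*} [Finite α] (le : α → α → Prop) (M : α → Prop)
    (htr : ∀ a b c, M a → M b → M c → le a b → le b c → le a c)
    (hglb : ∀ p q, M p → M q → (∃ l, M l ∧ le l p ∧ le l q) →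
      ∃ g, M g ∧ le g p ∧ le g q ∧ ∀ l, M l → le l p → le l q → le l g)
    (p q : α) (hp : M p) (hq : M q) (h : ∃ u, M u ∧ le p u ∧ le q u) :
    ∃ u, M u ∧ le p u ∧ le q u ∧ ∀ v, M v → le p v → le q v → le u v := by
  let r : {x // M x} → {x // M x} → Prop := fun x y => le x.1 y.1 ∧ ¬ le y.1 x.1
  haveI : IsTrans _ r := ⟨fun a b c hab hbc =>
    ⟨htr _ _ _ a.2 b.2 c.2 hab.1 hbc.1, fun hca => hab.2 (htr _ _ _ b.2 c.2 a.2 hbc.1 hca)⟩⟩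
  haveI : Std.Irrefl r := ⟨fun a ha => ha.2 ha.1⟩
  have wf : WellFounded r := Finite.wellFounded_of_trans_of_irrefl r
  obtain ⟨u0, hu0, h1, h2⟩ := h
  obtain ⟨u, ⟨hpu, hqu⟩, hmin⟩ := wf.has_min {x | le p x.1 ∧ le q x.1} ⟨⟨u0, hu0⟩, h1, h2⟩
  refine ⟨u.1, u.2, hpu, hqu, fun v hv hpv hqv => ?_⟩
  obtain ⟨g, hg, hgu, hgv, hgm⟩ := hglb u.1 v u.2 hv ⟨p, hp, hpu, hpv⟩
  have hug : le u.1 g := by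
    by_contra hn
    exact hmin ⟨g, hg⟩ ⟨hgm p hp hpu hpv, hgm q hq hqu hqv⟩ ⟨hgu, hn⟩
  exact htr _ _ _ u.2 hg hv hug hgv

theorem statement6 {R E : Type*} [Fintype R] [Fintype E] [DecidableEq R] [DecidableEq E]
    (𝒮 : Set (Finset (R × E))) (h𝒮 : IsElimSystem 𝒮)
    (A : R → E → SignType) (hA : ∀ i j, A i j ≠ 0)
    (Pa : Finset (Finset (R × E))) (hPa : IsColPartition Pa) :
    (∀ p q, memP 𝒮 p → memP 𝒮 q →
      (∃ l, memP 𝒮 l ∧ QLeR 𝒮 (SimA A Pa) l p ∧ QLeR 𝒮 (SimA A Pa) l q) →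
      ∃ g, memP 𝒮 g ∧ QLeR 𝒮 (SimA A Pa) g p ∧ QLeR 𝒮 (SimA A Pa) g q ∧
        ∀ l, memP 𝒮 l → QLeR 𝒮 (SimA A Pa) l p → QLeR 𝒮 (SimA A Pa) l q →
          QLeR 𝒮 (SimA A Pa) l g) ∧
    (∀ a ∈ AugSet 𝒮, ∀ b ∈ AugSet 𝒮,
      (∃ g, IsGLBIn (AugLe (QLeR 𝒮 (SimA A Pa))) (AugSet 𝒮) a b g) ∧
      (∃ u, IsLUBIn (AugLe (QLeR 𝒮 (SimA A Pa))) (AugSet 𝒮) a b u)) := by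
  have Q := qle6 𝒮 h𝒮 A hA Pa hPa
  have hglb := glb6 𝒮 h𝒮 A hA Pa hPa
  refine ⟨hglb, ?_⟩
  have hrefl : ∀ p, memP 𝒮 p → QLeR 𝒮 (SimA A Pa) p p := fun p hp =>
    (Q p p hp hp).2 ⟨fun _ _ => rfl, fun _ _ _ _ h => h⟩
  have htr : ∀ a b c, memP 𝒮 a → memP 𝒮 b → memP 𝒮 c → QLeR 𝒮 (SimA A Pa) a b →
      QLeR 𝒮 (SimA A Pa) b c → QLeR 𝒮 (SimA A Pa) a c := by
    intro a b c ha hb hc hab hbc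
    have h1 := (Q a b ha hb).1 hab
    have h2 := (Q b c hb hc).1 hbc
    refine (Q a c ha hc).2 ⟨fun i hi => ?_, fun π hπ s hs h =>
      h1.2 π hπ s hs (h2.2 π hπ s hs h)⟩
    have e := h1.1 i hi
    exact e.trans (h2.1 i (e ▸ hi))
  have hlub := lub6 (QLeR 𝒮 (SimA A Pa)) (memP 𝒮) htr hglb
  have hbotmem : Aug.bot ∈ AugSet 𝒮 := Or.inl rfl
  have htopmem : Aug.top ∈ AugSet 𝒮 := Or.inr (Or.inl rfl)
  have hofmem : ∀ p, memP 𝒮 p → Aug.of p ∈ AugSet 𝒮 := fun p hp => Or.inr (Or.inr ⟨p, hp, rfl⟩)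
  generalize QLeR 𝒮 (SimA A Pa) = le at *
  have hbot : ∀ x, AugLe le .bot x := fun x => by cases x <;> trivial
  have htop : ∀ x, AugLe le x .top := fun x => by cases x <;> trivial
  have hself : ∀ x ∈ AugSet 𝒮, AugLe le x x := by
    rintro x (rfl | rfl | ⟨p, hp, rfl⟩)
    · trivial
    · trivial
    · exact hrefl p hp
  rintro a ha b hb
  have ha' := ha
  have hb' := hb
  rcases ha with rfl | rfl | ⟨p, hp, rfl⟩
  · exact ⟨⟨.bot, ha', hbot _, hbot _, fun l _ h _ => h⟩,
      ⟨b, hb', hbot _, hself b hb', fun l _ _ h => h⟩⟩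
  · exact ⟨⟨b, hb', htop _, hself b hb', fun l _ _ h => h⟩,
      ⟨.top, ha', htop _, htop _, fun l _ h _ => h⟩⟩
  rcases hb with rfl | rfl | ⟨q, hq, rfl⟩
  · exact ⟨⟨.bot, hb', hbot _, hbot _, fun l _ _ h => h⟩,
      ⟨_, ha', hself _ ha', hbot _, fun l _ h _ => h⟩⟩
  · exact ⟨⟨_, ha', hself _ ha', htop _, fun l _ h _ => h⟩,
      ⟨.top, hb', htop _, htop _, fun l _ _ h => h⟩⟩
  constructor
  · by_cases h : ∃ l, memP 𝒮 l ∧ le l p ∧ le l q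
    · obtain ⟨g, hg, h1, h2, h3⟩ := hglb p q hp hq h
      refine ⟨.of g, hofmem g hg, h1, h2, ?_⟩
      rintro l (rfl | rfl | ⟨k, hk, rfl⟩) h4 h5
      · exact hbot _
      · exact h4.elim
      · exact h3 k hk h4 h5
    · refine ⟨.bot, hbotmem, hbot _, hbot _, ?_⟩
      rintro l (rfl | rfl | ⟨k, hk, rfl⟩) h4 h5
      · exact hbot _
      · exact h4.elim
      · exact (h ⟨k, hk, h4, h5⟩).elim
  · by_cases h : ∃ l, memP 𝒮 l ∧ le p l ∧ le q l
    · obtain ⟨g, hg, h1, h2, h3⟩ := hlub p q hp hq h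
      refine ⟨.of g, hofmem g hg, h1, h2, ?_⟩
      rintro l (rfl | rfl | ⟨k, hk, rfl⟩) h4 h5
      · exact h4.elim
      · exact htop _
      · exact h3 k hk h4 h5
    · refine ⟨.top, htopmem, htop _, htop _, ?_⟩
      rintro l (rfl | rfl | ⟨k, hk, rfl⟩) h4 h5
      · exact h4.elim
      · exact htop _
      · exact (h ⟨k, hk, h4, h5⟩).elim
end

section
/- Let 𝒮 be an elimination system on R×E and A ∈ {-1,+1}^{R×E}. Let Π̄ be a partition of R×E refining the partition into columns, let π ∈ Π̄ with |π| ≥ 2, let e ∈ π, and let Π̈ = (Π̄ ∖ {π}) ∪ {{e}, π∖{e}}. Let ∼̈_A and ∼̄_A denote the equivalence relations on P(𝒮) determined by Π̈ and Π̄ respectively (so ∼̈_A refines ∼̄_A), and let ≈ be the equivalence relation induced by ∼̄_A on the quotient poset P̈ := P(𝒮)/∼̈_A. Then every ≈-equivalence class in P̈ is either a singleton or consists of exactly three elements, two of which cover the third in P̈; that is, P̈/≈ is an elementary quotient of P̈. -/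
/-- The sign `s` occurs in the part `ρ`. -/
def DD {R E : Type*} (A : R → E → SignType) (p : (R → SignType) × Finset (R × E))
    (ρ : Finset (R × E)) (s : SignType) : Prop :=
  ∃ x ∈ ρ, x ∈ p.2 ∧ p.1 x.1 * A x.1 x.2 = s

lemma SA_iff_DD {R E : Type*} [DecidableEq R] [DecidableEq E] (A : R → E → SignType)
    (p : (R → SignType) × Finset (R × E)) (ρ : Finset (R × E)) (s : SignType) (hs : s ≠ 0) :
    (∃ x ∈ ρ, SA A p.1 p.2 x = s) ↔ DD A p ρ s := by
  unfold DD SA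
  constructor
  · rintro ⟨x, hx, h⟩
    by_cases hF : x ∈ p.2
    · exact ⟨x, hx, hF, by simpa [hF] using h⟩
    · simp [hF] at h
      exact absurd h.symm hs
  · rintro ⟨x, hx, hF, h⟩
    exact ⟨x, hx, by simpa [hF] using h⟩

lemma SimA_iff_DD {R E : Type*} [DecidableEq R] [DecidableEq E] (A : R → E → SignType)
    (Pa : Finset (Finset (R × E))) (p q : (R → SignType) × Finset (R × E)) :
    SimA A Pa p q ↔ p.1 = q.1 ∧ ∀ ρ ∈ Pa, ∀ s, s ≠ 0 → (DD A p ρ s ↔ DD A q ρ s) := by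
  unfold SimA MatSim
  refine and_congr_right fun _ => ?_
  refine forall_congr' fun ρ => forall_congr' fun _ => forall_congr' fun s =>
    forall_congr' fun hs => ?_
  rw [SA_iff_DD A p ρ s hs, SA_iff_DD A q ρ s hs]

lemma SimA_refl {R E : Type*} [DecidableEq R] [DecidableEq E] (A : R → E → SignType)
    (Pa : Finset (Finset (R × E))) (p : (R → SignType) × Finset (R × E)) : SimA A Pa p p :=
  ⟨rfl, fun _ _ _ _ => Iff.rfl⟩

lemma DD_mono {R E : Type*} (A : R → E → SignType)
    (p q : (R → SignType) × Finset (R × E)) (h1 : p.1 = q.1) (h2 : q.2 ⊆ p.2)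
    (ρ : Finset (R × E)) (s : SignType) (h : DD A q ρ s) : DD A p ρ s := by
  obtain ⟨x, hx, hF, h⟩ := h
  exact ⟨x, hx, h2 hF, by rw [h1]; exact h⟩

lemma cover_of_bit {R E : Type*} [DecidableEq R] [DecidableEq E]
    (𝒮 : Set (Finset (R × E))) (A : R → E → SignType)
    (Pa : Finset (Finset (R × E))) (p q : (R → SignType) × Finset (R × E))
    (hp : memP 𝒮 p) (hq : memP 𝒮 q) (h1 : p.1 = q.1) (h2 : q.2 ⊆ p.2)
    (ρ0 : Finset (R × E)) (hρ0 : ρ0 ∈ Pa) (s0 : SignType) (hs0 : s0 ≠ 0)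
    (hD : DD A p ρ0 s0) (hnD : ¬ DD A q ρ0 s0)
    (hrest : ∀ ρ ∈ Pa, ∀ s, s ≠ 0 → ¬ (ρ = ρ0 ∧ s = s0) → DD A p ρ s → DD A q ρ s) :
    QCovByR 𝒮 (SimA A Pa) p q := by
  refine ⟨hp, hq, ⟨p, q, hp, hq, SimA_refl _ _ _, SimA_refl _ _ _, ?_, h2⟩, ?_, ?_⟩
  · intro i _
    rw [h1]
  · intro h
    rw [SimA_iff_DD] at h
    exact hnD ((h.2 ρ0 hρ0 s0 hs0).1 hD)
  · rintro ⟨x, hx, ⟨u, v, hu, hv, hup, hvx, huv⟩, ⟨u', v', hu', hv', hux', hvq', huv'⟩, hxp, hxq⟩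
    rw [SimA_iff_DD] at hup hvx hux' hvq' hxp hxq
    have hx1 : x.1 = p.1 := by
      have a1 : SVLe p.1 x.1 := by
        rw [← hup.1, ← hvx.1]; exact huv.1
      have a2 : SVLe x.1 p.1 := by
        rw [h1, ← hux'.1, ← hvq'.1]; exact huv'.1
      funext i
      by_cases hi : x.1 i = 0
      · by_contra hne
        have : p.1 i ≠ 0 := fun h => hne (hi.trans h.symm)
        exact hne (a1 i this).symm
      · exact a2 i hi
    have m1 : ∀ ρ ∈ Pa, ∀ s, s ≠ 0 → DD A x ρ s → DD A p ρ s := by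
      intro ρ hρ s hs h
      rw [← hup.2 ρ hρ s hs]
      rw [← hvx.2 ρ hρ s hs] at h
      exact DD_mono A u v (by rw [hup.1, hvx.1, hx1]) huv.2 ρ s h
    have m2 : ∀ ρ ∈ Pa, ∀ s, s ≠ 0 → DD A q ρ s → DD A x ρ s := by
      intro ρ hρ s hs h
      rw [← hux'.2 ρ hρ s hs]
      rw [← hvq'.2 ρ hρ s hs] at h
      exact DD_mono A u' v' (by rw [hux'.1, hvq'.1, hx1, h1]) huv'.2 ρ s h
    by_cases hb : DD A x ρ0 s0
    · apply hxp
      refine ⟨hx1, fun ρ hρ s hs => ⟨m1 ρ hρ s hs, fun h => ?_⟩⟩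
      by_cases hc : ρ = ρ0 ∧ s = s0
      · rw [hc.1, hc.2]; exact hb
      · exact m2 ρ hρ s hs (hrest ρ hρ s hs hc h)
    · apply hxq
      refine ⟨hx1.trans h1, fun ρ hρ s hs => ⟨fun h => ?_, m2 ρ hρ s hs⟩⟩
      by_cases hc : ρ = ρ0 ∧ s = s0
      · rw [hc.1, hc.2] at h; exact absurd h hb
      · exact hrest ρ hρ s hs hc (m1 ρ hρ s hs h)

lemma join_exists {R E : Type*} [DecidableEq R] [DecidableEq E]
    (𝒮 : Set (Finset (R × E))) (h𝒮 : IsElimSystem 𝒮)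
    (A : R → E → SignType)
    (Pbar : Finset (Finset (R × E))) (hPbar : IsColPartition Pbar)
    (π : Finset (R × E)) (hπ : π ∈ Pbar) (e : R × E) (he : e ∈ π)
    (u v : (R → SignType) × Finset (R × E)) (hu : memP 𝒮 u) (hv : memP 𝒮 v)
    (huv : SimA A Pbar u v) (heu : e ∈ u.2) (t : SignType)
    (hK : DD A v (π.erase e) t) :
    ∃ c, memP 𝒮 c ∧ SimA A Pbar c v ∧ e ∈ c.2 ∧ DD A c (π.erase e) t := by
  rw [SimA_iff_DD] at huv
  obtain ⟨h1, h2⟩ := huv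
  obtain ⟨H, hH, hj, hk⟩ := h𝒮.E3 u.2 hu.1 v.2 hv.1 e.2
  refine ⟨(v.1, H), ⟨hH, ?_⟩, ?_, ?_, ?_⟩
  · intro i k hik
    have hu2 := hu.2 i k
    have hv2 := hv.2 i k
    rw [h1] at hu2
    have : (i, k) ∈ u.2 ∨ (i, k) ∈ v.2 := by
      by_cases hkj : k = e.2
      · subst hkj
        exact (hj i).1 hik
      · rcases hk k hkj with h | h | h
        · exact Or.inl ((h i).1 hik)
        · exact Or.inr ((h i).1 hik)
        · exact (h i).1 hik
    exact this.elim hu2 hv2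
  · rw [SimA_iff_DD]
    refine ⟨rfl, fun ρ hρ s hs => ?_⟩
    obtain ⟨x, hx⟩ := hPbar.1 ρ hρ
    have hcol : ∀ y ∈ ρ, y.2 = x.2 := fun y hy => hPbar.2.2 ρ hρ y hy x hx
    have huvs := h2 ρ hρ s hs
    have caseU : (∀ y ∈ ρ, (y ∈ H ↔ y ∈ u.2)) → (DD A (v.1, H) ρ s ↔ DD A v ρ s) := by
      intro h
      rw [← huvs]
      unfold DD
      rw [h1]
      exact exists_congr fun y => and_congr_right fun hy => by simp only [h y hy]
    have caseV : (∀ y ∈ ρ, (y ∈ H ↔ y ∈ v.2)) → (DD A (v.1, H) ρ s ↔ DD A v ρ s) := by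
      intro h
      unfold DD
      exact exists_congr fun y => and_congr_right fun hy => by simp only [h y hy]
    have caseUV : (∀ y ∈ ρ, (y ∈ H ↔ y ∈ u.2 ∨ y ∈ v.2)) →
        (DD A (v.1, H) ρ s ↔ DD A v ρ s) := by
      intro h
      constructor
      · rintro ⟨y, hy, hyH, hys⟩
        rcases (h y hy).1 hyH with h' | h'
        · exact huvs.1 ⟨y, hy, h', by rw [h1]; exact hys⟩
        · exact ⟨y, hy, h', hys⟩
      · rintro ⟨y, hy, hyH, hys⟩
        exact ⟨y, hy, (h y hy).2 (Or.inr hyH), hys⟩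
    by_cases hxj : x.2 = e.2
    · apply caseUV
      rintro ⟨i, k⟩ hy
      have : k = e.2 := (hcol _ hy).trans hxj
      subst this
      exact hj i
    · rcases hk x.2 hxj with h | h | h
      · apply caseU
        rintro ⟨i, k⟩ hy
        have : k = x.2 := hcol _ hy
        subst this
        exact h i
      · apply caseV
        rintro ⟨i, k⟩ hy
        have : k = x.2 := hcol _ hy
        subst this
        exact h i
      · apply caseUV
        rintro ⟨i, k⟩ hy
        have : k = x.2 := hcol _ hy
        subst this
        exact h i
  · exact (hj e.1).2 (Or.inl heu)
  · obtain ⟨⟨i, k⟩, hy, hyv, hyt⟩ := hK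
    refine ⟨(i, k), hy, ?_, hyt⟩
    have : k = e.2 := hPbar.2.2 π hπ _ (Finset.mem_of_mem_erase hy) e he
    subst this
    exact (hj i).2 (Or.inr hyv)

/-! Statement 7: splitting one part `π` of the partition `Π̄` into `{e}` and `π∖{e}` yields
a finer partition `Π̈`; the equivalence relation `∼̄_A` induces on `P̈ = P(𝒮)/∼̈_A` an
elementary quotient: every induced class is a singleton or consists of exactly three
elements, two of which cover the third in `P̈`. -/

theorem statement7 {R E : Type*} [Fintype R] [Fintype E] [DecidableEq R] [DecidableEq E]
    (𝒮 : Set (Finset (R × E))) (h𝒮 : IsElimSystem 𝒮)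
    (A : R → E → SignType) (hA : ∀ i j, A i j ≠ 0)
    (Pbar : Finset (Finset (R × E))) (hPbar : IsColPartition Pbar)
    (π : Finset (R × E)) (hπ : π ∈ Pbar) (hπ2 : 2 ≤ π.card)
    (e : R × E) (he : e ∈ π)
    (Pddot : Finset (Finset (R × E)))
    (hPddot : Pddot = insert {e} (insert (π.erase e) (Pbar.erase π)))
    (p : (R → SignType) × Finset (R × E)) (hp : memP 𝒮 p) :
    -- the `∼̄_A`-class of `[p]` in `P̈` is a singleton ...
    (∀ q, memP 𝒮 q → SimA A Pbar q p → SimA A Pddot q p) ∨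
    -- ... or consists of exactly three elements, two of which cover the third in `P̈`
    (∃ p₁ p₂ p₃, memP 𝒮 p₁ ∧ memP 𝒮 p₂ ∧ memP 𝒮 p₃ ∧
      SimA A Pbar p₁ p ∧ SimA A Pbar p₂ p ∧ SimA A Pbar p₃ p ∧
      ¬ SimA A Pddot p₁ p₂ ∧ ¬ SimA A Pddot p₁ p₃ ∧ ¬ SimA A Pddot p₂ p₃ ∧
      (∀ q, memP 𝒮 q → SimA A Pbar q p →
        (SimA A Pddot q p₁ ∨ SimA A Pddot q p₂ ∨ SimA A Pddot q p₃)) ∧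
      QCovByR 𝒮 (SimA A Pddot) p₃ p₁ ∧ QCovByR 𝒮 (SimA A Pddot) p₃ p₂) := by
  have hdisj : ∀ ρ ∈ Pbar, ρ ≠ π → ∀ x ∈ ρ, x ∉ π := by
    intro ρ hρ hne x hx hxπ
    exact hne ((hPbar.2.1 x).unique ⟨hρ, hx⟩ ⟨hπ, hxπ⟩)
  have hcolπ : ∀ x ∈ π, x.2 = e.2 := fun x hx => hPbar.2.2 π hπ x hx e he
  obtain ⟨t, ht⟩ : ∃ t, t = p.1 e.1 * A e.1 e.2 := ⟨_, rfl⟩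
  have hD1 : ∀ q : (R → SignType) × Finset (R × E), q.1 = p.1 → ∀ s,
      (DD A q {e} s ↔ e ∈ q.2 ∧ t = s) := by
    intro q hq s
    simp [DD, hq, ht]
  have hDπ : ∀ q : (R → SignType) × Finset (R × E), q.1 = p.1 → ∀ s,
      (DD A q π s ↔ (e ∈ q.2 ∧ t = s) ∨ DD A q (π.erase e) s) := by
    intro q hq s
    constructor
    · rintro ⟨x, hx, hxq, hs⟩
      by_cases hxe : x = e
      · subst hxe
        exact Or.inl ⟨hxq, by rw [ht, ← hq]; exact hs⟩
      · exact Or.inr ⟨x, Finset.mem_erase.2 ⟨hxe, hx⟩, hxq, hs⟩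
    · rintro (⟨h, hs⟩ | ⟨x, hx, hxq, hs⟩)
      · exact ⟨e, he, h, by rw [hq, ← ht]; exact hs⟩
      · exact ⟨x, Finset.mem_of_mem_erase hx, hxq, hs⟩
  have het : ∀ q, memP 𝒮 q → q.1 = p.1 → e ∈ q.2 → t ≠ 0 := by
    intro q hq h1 heq h0
    have := hq.2 e.1 e.2 heq
    rw [h1] at this
    rw [ht] at h0
    rcases mul_eq_zero.1 h0 with h | h
    · exact this h
    · exact hA _ _ h
  -- characterisation of the finer relation inside a coarse class
  have hchar : ∀ q r, memP 𝒮 q → memP 𝒮 r → SimA A Pbar q p → SimA A Pbar r p →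
      (e ∈ q.2 ↔ e ∈ r.2) → (DD A q (π.erase e) t ↔ DD A r (π.erase e) t) →
      SimA A Pddot q r := by
    intro q r hq hr hqp hrp hE hK
    rw [SimA_iff_DD] at hqp hrp ⊢
    refine ⟨hqp.1.trans hrp.1.symm, fun ρ hρ s hs => ?_⟩
    rw [hPddot, Finset.mem_insert, Finset.mem_insert, Finset.mem_erase] at hρ
    rcases hρ with rfl | rfl | ⟨_, hρ⟩
    · rw [hD1 q hqp.1, hD1 r hrp.1, hE]
    · by_cases hst : t = s
      · rw [← hst]; exact hK
      · have h := (hqp.2 π hπ s hs).trans (hrp.2 π hπ s hs).symm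
        rw [hDπ q hqp.1, hDπ r hrp.1] at h
        simpa [hst] using h
    · exact (hqp.2 ρ hρ s hs).trans (hrp.2 ρ hρ s hs).symm
  have hE1 : {e} ∈ Pddot := by rw [hPddot]; simp
  have hE2 : π.erase e ∈ Pddot := by rw [hPddot]; simp
  by_cases hc : ∃ c, memP 𝒮 c ∧ SimA A Pbar c p ∧ e ∈ c.2 ∧ DD A c (π.erase e) t
  · right
    obtain ⟨c, hcm, hcp, hec, hKc⟩ := hc
    have hcp' := hcp
    rw [SimA_iff_DD] at hcp'
    have hc1 := hcp'.1
    have ht0 : t ≠ 0 := het c hcm hc1 hec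
    obtain ⟨x0, hx0, hx0c, hx0t⟩ := id hKc
    have hx0' := Finset.mem_erase.1 hx0
    -- the element without `e`
    obtain ⟨a, ha⟩ : ∃ a : (R → SignType) × Finset (R × E), a = (c.1, c.2.erase e) := ⟨_, rfl⟩
    have ha1 : a.1 = c.1 := by rw [ha]
    have ha2 : ∀ x, x ∈ a.2 ↔ x ≠ e ∧ x ∈ c.2 := by intro x; rw [ha]; simp
    have has : a.2 ⊆ c.2 := fun x hx => ((ha2 x).1 hx).2
    -- the element without the sign `t` in `π.erase e`
    obtain ⟨b, hb⟩ : ∃ b : (R → SignType) × Finset (R × E),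
      b = (c.1, c.2.filter fun x => ¬ (x ∈ π.erase e ∧ c.1 x.1 * A x.1 x.2 = t)) := ⟨_, rfl⟩
    have hb1 : b.1 = c.1 := by rw [hb]
    have hb2 : ∀ x, x ∈ b.2 ↔ x ∈ c.2 ∧ ¬ (x ∈ π.erase e ∧ c.1 x.1 * A x.1 x.2 = t) := by
      intro x; rw [hb]; simp only [Finset.mem_filter]
    have hbs : b.2 ⊆ c.2 := fun x hx => ((hb2 x).1 hx).1
    have heb : e ∈ b.2 := (hb2 e).2 ⟨hec, by simp⟩
    have hea : e ∉ a.2 := fun h => ((ha2 e).1 h).1 rfl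
    have hKa : DD A a (π.erase e) t :=
      ⟨x0, hx0, (ha2 x0).2 ⟨hx0'.1, hx0c⟩, by rw [ha1]; exact hx0t⟩
    have hKb : ¬ DD A b (π.erase e) t := by
      rintro ⟨x, hx, hxb, hxt⟩
      rw [hb1] at hxt
      exact ((hb2 x).1 hxb).2 ⟨hx, hxt⟩
    have ham : memP 𝒮 a := by
      refine ⟨h𝒮.E2 a.2 c.2 hcm.1 has ?_, fun i j h => ?_⟩
      · intro j
        by_cases hj : j = e.2
        · refine ⟨x0.1, (ha2 _).2 ?_⟩
          rw [hj, ← hcolπ x0 hx0'.2]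
          exact ⟨hx0'.1, hx0c⟩
        · obtain ⟨i, hi⟩ := h𝒮.E1 c.2 hcm.1 j
          refine ⟨i, (ha2 _).2 ⟨?_, hi⟩⟩
          rintro rfl
          exact hj rfl
      · rw [ha1]; exact hcm.2 i j (has h)
    have hbm : memP 𝒮 b := by
      refine ⟨h𝒮.E2 b.2 c.2 hcm.1 hbs ?_, fun i j h => ?_⟩
      · intro j
        by_cases hj : j = e.2
        · exact ⟨e.1, by rw [hj]; exact heb⟩
        · obtain ⟨i, hi⟩ := h𝒮.E1 c.2 hcm.1 j
          refine ⟨i, (hb2 _).2 ⟨hi, ?_⟩⟩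
          rintro ⟨h, _⟩
          exact hj (hcolπ _ (Finset.mem_of_mem_erase h))
      · rw [hb1]; exact hcm.2 i j (hbs h)
    have hao : ∀ ρ, e ∉ ρ → ∀ s, DD A c ρ s → DD A a ρ s := by
      rintro ρ hρ s ⟨x, hx, hxc, hxs⟩
      refine ⟨x, hx, (ha2 x).2 ⟨?_, hxc⟩, by rw [ha1]; exact hxs⟩
      rintro rfl
      exact hρ hx
    have hbo : ∀ ρ s, (∀ x ∈ ρ, x ∈ π.erase e → s ≠ t) → DD A c ρ s → DD A b ρ s := by
      rintro ρ s hρ ⟨x, hx, hxc, hxs⟩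
      refine ⟨x, hx, (hb2 x).2 ⟨hxc, ?_⟩, by rw [hb1]; exact hxs⟩
      rintro ⟨h, h'⟩
      exact hρ x hx h (hxs.symm.trans h')
    have hap : SimA A Pbar a p := by
      rw [SimA_iff_DD]
      refine ⟨ha1.trans hc1, fun ρ hρ s hs => ?_⟩
      rw [← hcp'.2 ρ hρ s hs]
      refine ⟨DD_mono A c a ha1.symm has ρ s, fun h => ?_⟩
      by_cases hρπ : ρ = π
      · rw [hρπ] at h ⊢
        rw [hDπ c hc1] at h
        rw [hDπ a (ha1.trans hc1)]
        right
        rcases h with ⟨_, rfl⟩ | h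
        · exact hKa
        · exact hao _ (by simp) s h
      · exact hao ρ (fun h' => hdisj ρ hρ hρπ e h' he) s h
    have hbp : SimA A Pbar b p := by
      rw [SimA_iff_DD]
      refine ⟨hb1.trans hc1, fun ρ hρ s hs => ?_⟩
      rw [← hcp'.2 ρ hρ s hs]
      refine ⟨DD_mono A c b hb1.symm hbs ρ s, fun h => ?_⟩
      by_cases hρπ : ρ = π
      · rw [hρπ] at h ⊢
        by_cases hst : t = s
        · rw [hDπ b (hb1.trans hc1)]
          exact Or.inl ⟨heb, hst⟩
        · exact hbo π s (fun _ _ _ h' => hst h'.symm) h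
      · exact hbo ρ s (fun x hx hx' _ =>
          hdisj ρ hρ hρπ x hx (Finset.mem_of_mem_erase hx')) h
    have nE : ∀ q r : (R → SignType) × Finset (R × E), q.1 = p.1 → r.1 = p.1 →
        SimA A Pddot q r → (e ∈ q.2 ↔ e ∈ r.2) := by
      intro q r hq hr h
      rw [SimA_iff_DD] at h
      have := h.2 {e} hE1 t ht0
      rw [hD1 q hq, hD1 r hr] at this
      simpa using this
    have nK : ∀ q r : (R → SignType) × Finset (R × E),
        SimA A Pddot q r → (DD A q (π.erase e) t ↔ DD A r (π.erase e) t) := by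
      intro q r h
      rw [SimA_iff_DD] at h
      exact h.2 _ hE2 t ht0
    refine ⟨a, b, c, ham, hbm, hcm, hap, hbp, hcp, ?_, ?_, ?_, ?_, ?_, ?_⟩
    · exact fun h => hea ((nE a b (ha1.trans hc1) (hb1.trans hc1) h).2 heb)
    · exact fun h => hea ((nE a c (ha1.trans hc1) hc1 h).2 hec)
    · exact fun h => hKb ((nK b c h).2 hKc)
    · intro q hq hqp
      by_cases heq : e ∈ q.2
      · by_cases hKq : DD A q (π.erase e) t
        · exact Or.inr (Or.inr (hchar q c hq hcm hqp hcp (iff_of_true heq hec)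
            (iff_of_true hKq hKc)))
        · exact Or.inr (Or.inl (hchar q b hq hbm hqp hbp (iff_of_true heq heb)
            (iff_of_false hKq hKb)))
      · have hKq : DD A q (π.erase e) t := by
          have hqp' := hqp
          rw [SimA_iff_DD] at hqp'
          have h := (hqp'.2 π hπ t ht0).2 ((hcp'.2 π hπ t ht0).1
            ((hDπ c hc1 t).2 (Or.inl ⟨hec, rfl⟩)))
          rw [hDπ q hqp'.1] at h
          exact h.resolve_left fun h => heq h.1
        exact Or.inl (hchar q a hq ham hqp hap (iff_of_false heq hea) (iff_of_true hKq hKa))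
    · refine cover_of_bit 𝒮 A Pddot c a hcm ham ha1.symm has {e} hE1 t ht0
        ((hD1 c hc1 t).2 ⟨hec, rfl⟩) (fun h => hea ((hD1 a (ha1.trans hc1) t).1 h).1) ?_
      intro ρ hρ s hs hne h
      rw [hPddot, Finset.mem_insert, Finset.mem_insert, Finset.mem_erase] at hρ
      rcases hρ with rfl | rfl | ⟨hρπ, hρ⟩
      · exact absurd ⟨rfl, ((hD1 c hc1 s).1 h).2.symm⟩ hne
      · exact hao _ (by simp) s h
      · exact hao ρ (fun h' => hdisj ρ hρ hρπ e h' he) s h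
    · refine cover_of_bit 𝒮 A Pddot c b hcm hbm hb1.symm hbs (π.erase e) hE2 t ht0 hKc hKb ?_
      intro ρ hρ s hs hne h
      rw [hPddot, Finset.mem_insert, Finset.mem_insert, Finset.mem_erase] at hρ
      rcases hρ with rfl | rfl | ⟨hρπ, hρ⟩
      · exact (hD1 b (hb1.trans hc1) s).2 ⟨heb, ((hD1 c hc1 s).1 h).2⟩
      · exact hbo _ s (fun _ _ _ h' => hne ⟨rfl, h'⟩) h
      · exact hbo ρ s (fun x hx hx' _ =>
          hdisj ρ hρ hρπ x hx (Finset.mem_of_mem_erase hx')) h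
  · left
    intro q hq hqp
    have hpp := SimA_refl A Pbar p
    have hqp' := hqp
    rw [SimA_iff_DD] at hqp'
    by_cases ht0 : t = 0
    · have e1 : e ∉ q.2 := fun h => het q hq hqp'.1 h ht0
      have e2 : e ∉ p.2 := fun h => het p hp rfl h ht0
      rw [SimA_iff_DD]
      refine ⟨hqp'.1, fun ρ hρ s hs => ?_⟩
      rw [hPddot, Finset.mem_insert, Finset.mem_insert, Finset.mem_erase] at hρ
      rcases hρ with rfl | rfl | ⟨_, hρ⟩
      · rw [hD1 q hqp'.1, hD1 p rfl]
        simp [e1, e2]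
      · have h := hqp'.2 π hπ s hs
        rw [hDπ q hqp'.1, hDπ p rfl] at h
        simpa [e1, e2] using h
      · exact hqp'.2 ρ hρ s hs
    · have hpq : SimA A Pbar p q := by
        rw [SimA_iff_DD]
        exact ⟨hqp'.1.symm, fun ρ hρ s hs => (hqp'.2 ρ hρ s hs).symm⟩
      have n1 : ¬ (e ∈ q.2 ∧ DD A p (π.erase e) t) := fun h =>
        hc (join_exists 𝒮 h𝒮 A Pbar hPbar π hπ e he q p hq hp hqp h.1 t h.2)
      have n2 : ¬ (e ∈ p.2 ∧ DD A q (π.erase e) t) := by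
        intro h
        obtain ⟨c, h1, h2, h3, h4⟩ :=
          join_exists 𝒮 h𝒮 A Pbar hPbar π hπ e he p q hp hq hpq h.1 t h.2
        refine hc ⟨c, h1, ?_, h3, h4⟩
        rw [SimA_iff_DD] at h2 ⊢
        exact ⟨h2.1.trans hqp'.1, fun ρ hρ s hs =>
          (h2.2 ρ hρ s hs).trans (hqp'.2 ρ hρ s hs)⟩
      have n3 : ¬ (e ∈ q.2 ∧ DD A q (π.erase e) t) := fun h => hc ⟨q, hq, hqp, h.1, h.2⟩
      have n4 : ¬ (e ∈ p.2 ∧ DD A p (π.erase e) t) := fun h => hc ⟨p, hp, hpp, h.1, h.2⟩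
      have h := hqp'.2 π hπ t ht0
      rw [hDπ q hqp'.1, hDπ p rfl] at h
      simp only [and_true] at h
      apply hchar q p hq hp hqp hpp <;> tauto
end

section
/- Let 𝒮 be an elimination system on R×E, A ∈ {-1,+1}^{R×E}, and Π a partition of R×E refining the partition into columns. Then the quotient P(𝒮)/∼_A admits a factorization into elementary quotients: there exist posets P(𝒮) = P_0, P_1, …, P_k = P(𝒮)/∼_A such that for each i = 1,…,k, P_i is an elementary homogeneous quotient of P_{i-1}, and such that for each i = 0,1,…,k−1 the augmented poset L(P_i) (P_i with a new minimum and a new maximum adjoined) is a lattice. -/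
/-- A family of equivalence relations on positions, indexed by sign vectors, which refines the
columns and is compatible with the order on sign vectors. -/
structure GoodE {R E : Type*} (e : (R → SignType) → R × E → R × E → Prop) : Prop where
  rfl' : ∀ S x, e S x x
  symm' : ∀ S x y, e S x y → e S y x
  trans' : ∀ S x y z, e S x y → e S y z → e S x z
  col : ∀ S x y, e S x y → x.2 = y.2
  up : ∀ S T x y, SVLe S T → S x.1 ≠ 0 → S y.1 ≠ 0 → e S x y → e T x y
  down : ∀ S T x y, SVLe S T → S x.1 ≠ 0 → S y.1 ≠ 0 → e T x y → e S x y

/-- The relation on pairs: same sign vector and the same set of blocks hit. -/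
def SimE {R E : Type*} (e : (R → SignType) → R × E → R × E → Prop)
    (p q : (R → SignType) × Finset (R × E)) : Prop :=
  p.1 = q.1 ∧ (∀ x ∈ p.2, ∃ y ∈ q.2, e p.1 x y) ∧ (∀ y ∈ q.2, ∃ x ∈ p.2, e p.1 x y)

/-- Explicit form of the quotient order. -/
def LE' {R E : Type*} (e : (R → SignType) → R × E → R × E → Prop)
    (p q : (R → SignType) × Finset (R × E)) : Prop :=
  SVLe p.1 q.1 ∧ ∀ y ∈ q.2, ∃ x ∈ p.2, e q.1 x y

section helpers
set_option linter.unusedSectionVars false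
variable {R E : Type*} [DecidableEq R] [DecidableEq E] {e e' : (R → SignType) → R × E → R × E → Prop}
  {𝒮 : Set (Finset (R × E))}

theorem SVLe.rfl'' (S : R → SignType) : SVLe S S := fun _ _ => rfl

theorem SVLe.antisymm' {S T : R → SignType} (h : SVLe S T) (h' : SVLe T S) : S = T := by
  funext i
  by_cases hi : S i = 0
  · by_cases ht : T i = 0
    · rw [hi, ht]
    · exact (h' i ht).symm
  · exact h i hi

theorem SVLe.ne {S T : R → SignType} (h : SVLe S T) {i : R} (hi : S i ≠ 0) : T i ≠ 0 := by
  rw [← h i hi]; exact hi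

theorem SVLe.trans' {S T U : R → SignType} (h : SVLe S T) (h' : SVLe T U) : SVLe S U :=
  fun i hi => (h i hi).trans (h' i (h.ne hi))

theorem SimE.refl' (he : GoodE e) (p : (R → SignType) × Finset (R × E)) : SimE e p p :=
  ⟨rfl, fun x hx => ⟨x, hx, he.rfl' _ _⟩, fun x hx => ⟨x, hx, he.rfl' _ _⟩⟩

theorem SimE.symm' (he : GoodE e) {p q : (R → SignType) × Finset (R × E)} (h : SimE e p q) :
    SimE e q p := by
  obtain ⟨h1, h2, h3⟩ := h
  refine ⟨h1.symm, fun x hx => ?_, fun x hx => ?_⟩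
  · obtain ⟨y, hy, h⟩ := h3 x hx
    exact ⟨y, hy, h1 ▸ he.symm' _ _ _ h⟩
  · obtain ⟨y, hy, h⟩ := h2 x hx
    exact ⟨y, hy, h1 ▸ he.symm' _ _ _ h⟩

theorem SimE.trans' (he : GoodE e) {p q r : (R → SignType) × Finset (R × E)} (h : SimE e p q)
    (h' : SimE e q r) : SimE e p r := by
  obtain ⟨h1, h2, h3⟩ := h
  obtain ⟨h1', h2', h3'⟩ := h'
  refine ⟨h1.trans h1', fun x hx => ?_, fun x hx => ?_⟩
  · obtain ⟨y, hy, h⟩ := h2 x hx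
    obtain ⟨z, hz, h'⟩ := h2' y hy
    exact ⟨z, hz, he.trans' _ _ _ _ h (h1 ▸ h')⟩
  · obtain ⟨y, hy, h⟩ := h3' x hx
    obtain ⟨z, hz, h'⟩ := h3 y hy
    exact ⟨z, hz, he.trans' _ _ _ _ h' (h1 ▸ h)⟩

theorem LE'.of_QLeR (he : GoodE e) {p q : (R → SignType) × Finset (R × E)}
    (hp : memP 𝒮 p) (h : QLeR 𝒮 (SimE e) p q) : LE' e p q := by
  obtain ⟨u, v, hu, hv, ⟨hup, hup1, hup2⟩, ⟨hvq, hvq1, hvq2⟩, huv, huv'⟩ := h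
  have hs : SVLe p.1 q.1 := by rw [← hup, ← hvq]; exact huv
  refine ⟨hs, fun y hy => ?_⟩
  obtain ⟨x, hx, hxy⟩ := hvq2 y hy
  obtain ⟨w, hw, hxw⟩ := hup1 x (huv' hx)
  refine ⟨w, hw, ?_⟩
  rw [hup] at hxw
  have h1 := he.up _ _ _ _ hs (hup ▸ hu.2 x.1 x.2 (huv' hx)) (hp.2 w.1 w.2 hw) hxw
  rw [hvq] at hxy
  exact he.trans' _ _ _ _ (he.symm' _ _ _ h1) hxy

theorem LE'.lift (h𝒮 : IsElimSystem 𝒮) (he : GoodE e) {p q : (R → SignType) × Finset (R × E)}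
    (hp : memP 𝒮 p) (hq : memP 𝒮 q) (h : LE' e p q) :
    ∃ v, memP 𝒮 v ∧ SimE e v q ∧ PLe p v := by
  classical
  obtain ⟨hs, h⟩ := h
  refine ⟨(q.1, p.2.filter fun x => ∃ y ∈ q.2, e q.1 x y), ⟨?_, ?_⟩, ⟨rfl, ?_, ?_⟩, hs, ?_⟩
  · refine h𝒮.E2 _ _ hp.1 (Finset.filter_subset _ _) fun j => ?_
    obtain ⟨i, hi⟩ := h𝒮.E1 _ hq.1 j
    obtain ⟨x, hx, hxy⟩ := h _ hi
    have := he.col _ _ _ hxy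
    obtain ⟨a, b⟩ := x
    simp only at this
    subst this
    exact ⟨a, Finset.mem_filter.2 ⟨hx, _, hi, hxy⟩⟩
  · intro i j hij
    exact hs.ne (hp.2 i j (Finset.mem_filter.1 hij).1)
  · intro x hx
    exact (Finset.mem_filter.1 hx).2
  · intro y hy
    obtain ⟨x, hx, hxy⟩ := h y hy
    exact ⟨x, Finset.mem_filter.2 ⟨hx, y, hy, hxy⟩, hxy⟩
  · exact Finset.filter_subset _ _

theorem QLeR_iff (h𝒮 : IsElimSystem 𝒮) (he : GoodE e) {p q : (R → SignType) × Finset (R × E)}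
    (hp : memP 𝒮 p) (hq : memP 𝒮 q) : QLeR 𝒮 (SimE e) p q ↔ LE' e p q := by
  refine ⟨LE'.of_QLeR he hp, fun h => ?_⟩
  obtain ⟨v, hv, hvq, hpv⟩ := LE'.lift h𝒮 he hp hq h
  exact ⟨p, v, hp, hv, SimE.refl' he p, hvq, hpv⟩

theorem LE'.refl' (he : GoodE e) (p : (R → SignType) × Finset (R × E)) : LE' e p p :=
  ⟨SVLe.rfl'' _, fun x hx => ⟨x, hx, he.rfl' _ _⟩⟩

theorem exists_glb (h𝒮 : IsElimSystem 𝒮) (he : GoodE e) {p q l : (R → SignType) × Finset (R × E)}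
    (hp : memP 𝒮 p) (hl : memP 𝒮 l) (hlp : LE' e l p) (hlq : LE' e l q) :
    ∃ g, memP 𝒮 g ∧ LE' e g p ∧ LE' e g q ∧
      ∀ l', memP 𝒮 l' → LE' e l' p → LE' e l' q → LE' e l' g := by
  classical
  set S : R → SignType := fun i => if p.1 i = q.1 i then p.1 i else 0 with hS
  have hSp : SVLe S p.1 := by intro i; simp only [hS]; split_ifs <;> simp
  have hSq : SVLe S q.1 := by
    intro i; simp only [hS]; split_ifs with h
    · intro _; exact h
    · simp
  have hmax : ∀ l' : R → SignType, SVLe l' p.1 → SVLe l' q.1 → SVLe l' S := by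
    intro l' h1 h2 i hi
    simp only [hS]
    rw [if_pos ((h1 i hi).symm.trans (h2 i hi))]
    exact h1 i hi
  have hlS := hmax _ hlp.1 hlq.1
  refine ⟨(S, l.2.filter fun x => (∃ y ∈ p.2, e p.1 x y) ∨ ∃ y ∈ q.2, e q.1 x y),
    ⟨?_, ?_⟩, ⟨hSp, ?_⟩, ⟨hSq, ?_⟩, ?_⟩
  · refine h𝒮.E2 _ _ hl.1 (Finset.filter_subset _ _) fun j => ?_
    obtain ⟨i, hi⟩ := h𝒮.E1 _ hp.1 j
    obtain ⟨x, hx, hxy⟩ := hlp.2 _ hi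
    have := he.col _ _ _ hxy
    obtain ⟨a, b⟩ := x
    simp only at this
    subst this
    exact ⟨a, Finset.mem_filter.2 ⟨hx, Or.inl ⟨_, hi, hxy⟩⟩⟩
  · intro i j hij
    exact hlS.ne (hl.2 i j (Finset.mem_filter.1 hij).1)
  · intro y hy
    obtain ⟨x, hx, hxy⟩ := hlp.2 _ hy
    exact ⟨x, Finset.mem_filter.2 ⟨hx, Or.inl ⟨y, hy, hxy⟩⟩, hxy⟩
  · intro y hy
    obtain ⟨x, hx, hxy⟩ := hlq.2 _ hy
    exact ⟨x, Finset.mem_filter.2 ⟨hx, Or.inr ⟨y, hy, hxy⟩⟩, hxy⟩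
  · intro l' hl' h1 h2
    have hl'S := hmax _ h1.1 h2.1
    refine ⟨hl'S, fun y hy => ?_⟩
    obtain ⟨hyl, hy⟩ := Finset.mem_filter.1 hy
    have hyS : S y.1 ≠ 0 := hlS.ne (hl.2 y.1 y.2 hyl)
    rcases hy with ⟨y', hy', hyy'⟩ | ⟨y', hy', hyy'⟩
    · obtain ⟨x, hx, hxy⟩ := h1.2 _ hy'
      exact ⟨x, hx, he.down _ _ _ _ hSp (hl'S.ne (hl'.2 x.1 x.2 hx)) hyS
        (he.trans' _ _ _ _ hxy (he.symm' _ _ _ hyy'))⟩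
    · obtain ⟨x, hx, hxy⟩ := h2.2 _ hy'
      exact ⟨x, hx, he.down _ _ _ _ hSq (hl'S.ne (hl'.2 x.1 x.2 hx)) hyS
        (he.trans' _ _ _ _ hxy (he.symm' _ _ _ hyy'))⟩

theorem exists_lub (h𝒮 : IsElimSystem 𝒮) (he : GoodE e) {p q v : (R → SignType) × Finset (R × E)}
    (hp : memP 𝒮 p) (hq : memP 𝒮 q) (hv : memP 𝒮 v) (hpv : LE' e p v) (hqv : LE' e q v) :
    ∃ g, memP 𝒮 g ∧ LE' e p g ∧ LE' e q g ∧
      ∀ l', memP 𝒮 l' → LE' e p l' → LE' e q l' → LE' e g l' := by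
  classical
  set V : R → SignType := fun i => if p.1 i ≠ 0 then p.1 i else q.1 i with hV
  have hpV : SVLe p.1 V := by intro i hi; simp only [hV]; rw [if_pos hi]
  have hqV : SVLe q.1 V := by
    intro i hi; simp only [hV]; split_ifs with h
    · exact (hqv.1 i hi).trans (hpv.1 i h).symm
    · rfl
  have hmin : ∀ l' : R → SignType, SVLe p.1 l' → SVLe q.1 l' → SVLe V l' := by
    intro l' h1 h2 i
    simp only [hV]
    split_ifs with h
    · exact h1 i
    · exact h2 i
  have key : ∀ v : (R → SignType) × Finset (R × E), LE' e p v → LE' e q v → ∀ y ∈ v.2,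
      ∃ x ∈ p.2, (∃ x' ∈ q.2, e V x x') ∧ e v.1 x y := by
    intro v hpv hqv y hy
    obtain ⟨x, hx, hxy⟩ := hpv.2 _ hy
    obtain ⟨x', hx', hxy'⟩ := hqv.2 _ hy
    exact ⟨x, hx, ⟨x', hx', he.down _ _ _ _ (hmin _ hpv.1 hqv.1) (hpV.ne (hp.2 x.1 x.2 hx))
      (hqV.ne (hq.2 x'.1 x'.2 hx')) (he.trans' _ _ _ _ hxy (he.symm' _ _ _ hxy'))⟩, hxy⟩
  refine ⟨(V, p.2.filter fun x => ∃ y ∈ q.2, e V x y), ⟨?_, ?_⟩, ⟨hpV, ?_⟩, ⟨hqV, ?_⟩, ?_⟩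
  · refine h𝒮.E2 _ _ hp.1 (Finset.filter_subset _ _) fun j => ?_
    obtain ⟨i, hi⟩ := h𝒮.E1 _ hv.1 j
    obtain ⟨x, hx, hx', hxy⟩ := key v hpv hqv _ hi
    have := he.col _ _ _ hxy
    obtain ⟨a, b⟩ := x
    simp only at this
    subst this
    exact ⟨a, Finset.mem_filter.2 ⟨hx, hx'⟩⟩
  · intro i j hij
    exact hpV.ne (hp.2 i j (Finset.mem_filter.1 hij).1)
  · intro y hy
    exact ⟨y, (Finset.mem_filter.1 hy).1, he.rfl' _ _⟩
  · intro y hy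
    obtain ⟨x, hx, hxy⟩ := (Finset.mem_filter.1 hy).2
    exact ⟨x, hx, he.symm' _ _ _ hxy⟩
  · intro l' hl' h1 h2
    refine ⟨hmin _ h1.1 h2.1, fun y hy => ?_⟩
    obtain ⟨x, hx, hx', hxy⟩ := key l' h1 h2 _ hy
    exact ⟨x, Finset.mem_filter.2 ⟨hx, hx'⟩, hxy⟩

theorem aug_lattice (h𝒮 : IsElimSystem 𝒮) (he : GoodE e) :
    ∀ a ∈ AugSet 𝒮, ∀ b ∈ AugSet 𝒮,
        (∃ g, IsGLBIn (AugLe (QLeR 𝒮 (SimE e))) (AugSet 𝒮) a b g) ∧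
        (∃ u, IsLUBIn (AugLe (QLeR 𝒮 (SimE e))) (AugSet 𝒮) a b u) := by
  have hbot : (Aug.bot : Aug ((R → SignType) × Finset (R × E))) ∈ AugSet 𝒮 := Or.inl rfl
  have htop : (Aug.top : Aug ((R → SignType) × Finset (R × E))) ∈ AugSet 𝒮 := Or.inr (Or.inl rfl)
  have hb : ∀ x, AugLe (QLeR 𝒮 (SimE e)) .bot x := fun x => by cases x <;> trivial
  have ht : ∀ x, AugLe (QLeR 𝒮 (SimE e)) x .top := fun x => by cases x <;> trivial
  have hr : ∀ x ∈ AugSet 𝒮, AugLe (QLeR 𝒮 (SimE e)) x x := by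
    rintro x (rfl | rfl | ⟨p, hp, rfl⟩)
    · trivial
    · trivial
    · exact (QLeR_iff h𝒮 he hp hp).2 (LE'.refl' he p)
  intro a ha b hb'
  rcases ha with rfl | rfl | ⟨p, hp, rfl⟩
  · exact ⟨⟨.bot, hbot, hb _, hb _, fun l _ h _ => h⟩, ⟨b, hb', hb _, hr _ hb', fun l _ _ h => h⟩⟩
  · exact ⟨⟨b, hb', ht _, hr _ hb', fun l _ _ h => h⟩, ⟨.top, htop, ht _, ht _, fun l _ h _ => h⟩⟩
  have ha : (Aug.of p) ∈ AugSet 𝒮 := Or.inr (Or.inr ⟨p, hp, rfl⟩)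
  rcases hb' with rfl | rfl | ⟨q, hq, rfl⟩
  · exact ⟨⟨.bot, hbot, hb _, hb _, fun l _ _ h => h⟩, ⟨.of p, ha, hr _ ha, hb _, fun l _ h _ => h⟩⟩
  · exact ⟨⟨.of p, ha, hr _ ha, ht _, fun l _ h _ => h⟩, ⟨.top, htop, ht _, ht _, fun l _ _ h => h⟩⟩
  constructor
  · by_cases h : ∃ l, memP 𝒮 l ∧ LE' e l p ∧ LE' e l q
    · obtain ⟨l, hl, hlp, hlq⟩ := h
      obtain ⟨g, hg, h1, h2, h3⟩ := exists_glb h𝒮 he hp hl hlp hlq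
      refine ⟨.of g, Or.inr (Or.inr ⟨g, hg, rfl⟩), (QLeR_iff h𝒮 he hg hp).2 h1,
        (QLeR_iff h𝒮 he hg hq).2 h2, ?_⟩
      rintro x (rfl | rfl | ⟨r, hr, rfl⟩) k1 k2
      · exact hb _
      · exact absurd k1 (by simp [AugLe])
      · exact (QLeR_iff h𝒮 he hr hg).2 (h3 r hr ((QLeR_iff h𝒮 he hr hp).1 k1)
          ((QLeR_iff h𝒮 he hr hq).1 k2))
    · refine ⟨.bot, hbot, hb _, hb _, ?_⟩
      rintro x (rfl | rfl | ⟨r, hr, rfl⟩) k1 k2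
      · exact hb _
      · exact absurd k1 (by simp [AugLe])
      · exact absurd ⟨r, hr, (QLeR_iff h𝒮 he hr hp).1 k1, (QLeR_iff h𝒮 he hr hq).1 k2⟩ h
  · by_cases h : ∃ l, memP 𝒮 l ∧ LE' e p l ∧ LE' e q l
    · obtain ⟨l, hl, hlp, hlq⟩ := h
      obtain ⟨g, hg, h1, h2, h3⟩ := exists_lub h𝒮 he hp hq hl hlp hlq
      refine ⟨.of g, Or.inr (Or.inr ⟨g, hg, rfl⟩), (QLeR_iff h𝒮 he hp hg).2 h1,
        (QLeR_iff h𝒮 he hq hg).2 h2, ?_⟩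
      rintro x (rfl | rfl | ⟨r, hr, rfl⟩) k1 k2
      · exact absurd k1 (by simp [AugLe])
      · exact ht _
      · exact (QLeR_iff h𝒮 he hg hr).2 (h3 r hr ((QLeR_iff h𝒮 he hp hr).1 k1)
          ((QLeR_iff h𝒮 he hq hr).1 k2))
    · refine ⟨.top, htop, ht _, ht _, ?_⟩
      rintro x (rfl | rfl | ⟨r, hr, rfl⟩) k1 k2
      · exact absurd k1 (by simp [AugLe])
      · exact ht _
      · exact absurd ⟨r, hr, (QLeR_iff h𝒮 he hp hr).1 k1, (QLeR_iff h𝒮 he hq hr).1 k2⟩ h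

/-- `e'` arises from `e` by merging at most one pair of blocks for every sign vector. -/
def MergeStep (e e' : (R → SignType) → R × E → R × E → Prop) : Prop :=
  ∀ S, ∃ z w : R × E, z.2 = w.2 ∧ ∀ x y, e' S x y ↔
    (e S x y ∨ (e S x z ∧ e S y w) ∨ (e S x w ∧ e S y z))

theorem SimE.mono (hm : ∀ S x y, e S x y → e' S x y) {p q : (R → SignType) × Finset (R × E)}
    (h : SimE e p q) : SimE e' p q := by
  obtain ⟨h1, h2, h3⟩ := h
  refine ⟨h1, fun x hx => ?_, fun x hx => ?_⟩
  · obtain ⟨y, hy, h⟩ := h2 x hx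
    exact ⟨y, hy, hm _ _ _ h⟩
  · obtain ⟨y, hy, h⟩ := h3 x hx
    exact ⟨y, hy, hm _ _ _ h⟩

theorem step_homog (h𝒮 : IsElimSystem 𝒮) (he : GoodE e) (he' : GoodE e')
    (hm : ∀ S x y, e S x y → e' S x y)
    {p q u : (R → SignType) × Finset (R × E)} (hp : memP 𝒮 p) (hq : memP 𝒮 q) (hu : memP 𝒮 u)
    (hpq : QLeR 𝒮 (SimE e) p q) (hup : SimE e' u p) :
    ∃ v, memP 𝒮 v ∧ SimE e' v q ∧ QLeR 𝒮 (SimE e) u v := by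
  obtain ⟨u1, v1, hu1, hv1, h1, h2, h3⟩ := hpq
  have : QLeR 𝒮 (SimE e') u q := ⟨u1, v1, hu1, hv1,
    SimE.trans' he' (SimE.mono hm h1) (SimE.symm' he' hup), SimE.mono hm h2, h3⟩
  obtain ⟨v, hv, hvq, huv⟩ := LE'.lift h𝒮 he' hu hq (LE'.of_QLeR he' hu this)
  exact ⟨v, hv, hvq, u, v, hu, hv, SimE.refl' he u, SimE.refl' he v, huv⟩

/-- `F` meets the block of `b`. -/
def Hits (e : (R → SignType) → R × E → R × E → Prop) (S : R → SignType) (F : Finset (R × E))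
    (b : R × E) : Prop := ∃ x ∈ F, e S x b

theorem SimE_iff_hits (he : GoodE e) (S : R → SignType) (F G : Finset (R × E)) :
    SimE e (S, F) (S, G) ↔ ∀ b, Hits e S F b ↔ Hits e S G b := by
  constructor
  · rintro ⟨-, h2, h3⟩ b
    constructor
    · rintro ⟨x, hx, hb⟩
      obtain ⟨y, hy, hxy⟩ := h2 x hx
      exact ⟨y, hy, he.trans' _ _ _ _ (he.symm' _ _ _ hxy) hb⟩
    · rintro ⟨x, hx, hb⟩
      obtain ⟨y, hy, hxy⟩ := h3 x hx
      exact ⟨y, hy, he.trans' _ _ _ _ hxy hb⟩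
  · intro h
    refine ⟨rfl, fun x hx => ?_, fun y hy => ?_⟩
    · obtain ⟨y, hy, hyx⟩ := (h x).1 ⟨x, hx, he.rfl' _ _⟩
      exact ⟨y, hy, he.symm' _ _ _ hyx⟩
    · exact (h y).2 ⟨y, hy, he.rfl' _ _⟩

/-- Description of the coarser relation by block hitting. -/
theorem SimE'_iff_hits (he : GoodE e) (he' : GoodE e') (S : R → SignType) (z w : R × E)
    (hzw : ∀ x y, e' S x y ↔ (e S x y ∨ (e S x z ∧ e S y w) ∨ (e S x w ∧ e S y z)))
    (F G : Finset (R × E)) :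
    SimE e' (S, F) (S, G) ↔ (∀ b, ¬ e S b z → ¬ e S b w → (Hits e S F b ↔ Hits e S G b)) ∧
      ((Hits e S F z ∨ Hits e S F w) ↔ (Hits e S G z ∨ Hits e S G w)) := by
  have hz : ∀ F : Finset (R × E), Hits e' S F z ↔ (Hits e S F z ∨ Hits e S F w) := by
    intro F
    constructor
    · rintro ⟨x, hx, h⟩
      rcases (hzw x z).1 h with h | h | h
      · exact Or.inl ⟨x, hx, h⟩
      · exact Or.inl ⟨x, hx, h.1⟩
      · exact Or.inr ⟨x, hx, h.1⟩
    · rintro (⟨x, hx, h⟩ | ⟨x, hx, h⟩)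
      · exact ⟨x, hx, (hzw _ _).2 (Or.inl h)⟩
      · exact ⟨x, hx, (hzw _ _).2 (Or.inr (Or.inr ⟨h, he.rfl' _ _⟩))⟩
  have ho : ∀ (F : Finset (R × E)) b, ¬ e S b z → ¬ e S b w → (Hits e' S F b ↔ Hits e S F b) := by
    intro F b h1 h2
    constructor
    · rintro ⟨x, hx, h⟩
      rcases (hzw x b).1 h with h | h | h
      · exact ⟨x, hx, h⟩
      · exact absurd h.2 h2
      · exact absurd h.2 h1
    · rintro ⟨x, hx, h⟩
      exact ⟨x, hx, (hzw _ _).2 (Or.inl h)⟩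
  rw [SimE_iff_hits he']
  constructor
  · intro h
    refine ⟨fun b h1 h2 => ?_, ?_⟩
    · rw [← ho F b h1 h2, ← ho G b h1 h2, h b]
    · rw [← hz, ← hz, h z]
  · rintro ⟨h1, h2⟩ b
    by_cases hb : e' S b z
    · have : ∀ F, Hits e' S F b ↔ Hits e' S F z := fun F =>
        ⟨fun ⟨x, hx, h⟩ => ⟨x, hx, he'.trans' _ _ _ _ h hb⟩,
         fun ⟨x, hx, h⟩ => ⟨x, hx, he'.trans' _ _ _ _ h (he'.symm' _ _ _ hb)⟩⟩
      rw [this, this, hz, hz, h2]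
    · have h3 : ¬ e S b z := fun h => hb ((hzw _ _).2 (Or.inl h))
      have h4 : ¬ e S b w := fun h => hb ((hzw _ _).2 (Or.inr (Or.inr ⟨h, he.rfl' _ _⟩)))
      rw [ho F b h3 h4, ho G b h3 h4, h1 b h3 h4]

theorem Hits.congr (he : GoodE e) {S : R → SignType} {F : Finset (R × E)} {b c : R × E}
    (h : e S b c) : Hits e S F b ↔ Hits e S F c :=
  ⟨fun ⟨x, hx, h'⟩ => ⟨x, hx, he.trans' _ _ _ _ h' h⟩,
   fun ⟨x, hx, h'⟩ => ⟨x, hx, he.trans' _ _ _ _ h' (he.symm' _ _ _ h)⟩⟩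

/-- Equality of hit sets can be tested at `z`, at `w` and away from these two blocks. -/
theorem SimE_iff_hits3 (he : GoodE e) (S : R → SignType) (z w : R × E)
    (F G : Finset (R × E)) :
    SimE e (S, F) (S, G) ↔ (∀ b, ¬ e S b z → ¬ e S b w → (Hits e S F b ↔ Hits e S G b)) ∧
      (Hits e S F z ↔ Hits e S G z) ∧ (Hits e S F w ↔ Hits e S G w) := by
  rw [SimE_iff_hits he]
  constructor
  · intro h
    exact ⟨fun b _ _ => h b, h z, h w⟩
  · rintro ⟨h1, h2, h3⟩ b
    by_cases hz : e S b z
    · rw [Hits.congr he hz, Hits.congr he hz, h2]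
    by_cases hw : e S b w
    · rw [Hits.congr he hw, Hits.congr he hw, h3]
    exact h1 b hz hw

/-- Removing one block from `H`: result and covering. -/
theorem remove_block (h𝒮 : IsElimSystem 𝒮) (he : GoodE e) (S : R → SignType) (z w : R × E)
    (hcol : z.2 = w.2) (hne : ¬ e S z w) (H : Finset (R × E)) (hH : memP 𝒮 (S, H))
    (hz : Hits e S H z) (hw : Hits e S H w) :
    ∃ G, memP 𝒮 (S, G) ∧ (∀ b, ¬ e S b w → (Hits e S G b ↔ Hits e S H b)) ∧ ¬ Hits e S G w ∧
      QCovByR 𝒮 (SimE e) (S, H) (S, G) := by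
  classical
  obtain ⟨G, hG⟩ : ∃ G, G = H.filter fun x => ¬ e S x w := ⟨_, rfl⟩
  have hsub : G ⊆ H := hG ▸ Finset.filter_subset _ _
  have hits : ∀ b, ¬ e S b w → (Hits e S G b ↔ Hits e S H b) := by
    intro b hb
    constructor
    · rintro ⟨x, hx, h⟩
      exact ⟨x, hsub hx, h⟩
    · rintro ⟨x, hx, h⟩
      refine ⟨x, hG ▸ Finset.mem_filter.2 ⟨hx, fun h' => hb ?_⟩, h⟩
      exact he.trans' _ _ _ _ (he.symm' _ _ _ h) h'
  have hnw : ¬ Hits e S G w := by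
    rintro ⟨x, hx, h⟩
    rw [hG] at hx
    exact (Finset.mem_filter.1 hx).2 h
  have hmem : memP 𝒮 (S, G) := by
    refine ⟨h𝒮.E2 _ _ hH.1 hsub fun j => ?_, fun i j hij => hH.2 i j (hsub hij)⟩
    by_cases hj : j = w.2
    · obtain ⟨x, hx, h⟩ := (hits z hne).2 hz
      have := he.col _ _ _ h
      refine ⟨x.1, ?_⟩
      rw [hj, ← hcol, ← this]
      exact hx
    · obtain ⟨i, hi⟩ := h𝒮.E1 _ hH.1 j
      exact ⟨i, hG ▸ Finset.mem_filter.2 ⟨hi, fun h => hj (he.col _ _ _ h)⟩⟩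
  refine ⟨G, hmem, hits, hnw, hH, hmem, ?_, ?_, ?_⟩
  · exact ⟨_, _, hH, hmem, SimE.refl' he _, SimE.refl' he _, SVLe.rfl'' _, hsub⟩
  · intro h
    exact hnw (((SimE_iff_hits he _ _ _).1 h w).1 hw)
  · rintro ⟨⟨T, X⟩, hX, h1, h2, h3, h4⟩
    have h1 := LE'.of_QLeR he hH h1
    have h2 := LE'.of_QLeR he hX h2
    obtain rfl : S = T := h1.1.antisymm' h2.1
    have hHX : ∀ b, Hits e S X b → Hits e S H b := by
      rintro b ⟨x, hx, h⟩
      obtain ⟨y, hy, h'⟩ := h1.2 x hx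
      exact ⟨y, hy, he.trans' _ _ _ _ h' h⟩
    have hXG : ∀ b, Hits e S G b → Hits e S X b := by
      rintro b ⟨x, hx, h⟩
      obtain ⟨y, hy, h'⟩ := h2.2 x hx
      exact ⟨y, hy, he.trans' _ _ _ _ h' h⟩
    by_cases hXw : Hits e S X w
    · refine h3 ((SimE_iff_hits he _ _ _).2 fun b => ⟨hHX b, fun hb => ?_⟩)
      by_cases hbw : e S b w
      · exact (Hits.congr he hbw).2 hXw
      · exact hXG b ((hits b hbw).2 hb)
    · refine h4 ((SimE_iff_hits he _ _ _).2 fun b => ⟨fun hb => ?_, hXG b⟩)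
      by_cases hbw : e S b w
      · exact absurd ((Hits.congr he hbw).1 hb) hXw
      · exact (hits b hbw).2 (hHX b hb)

theorem step_elem (h𝒮 : IsElimSystem 𝒮) (he : GoodE e) (he' : GoodE e')
    (hstep : MergeStep e e') (p : (R → SignType) × Finset (R × E)) (hp : memP 𝒮 p) :
    (∀ q, memP 𝒮 q → SimE e' q p → SimE e q p) ∨
        (∃ p₁ p₂ p₃, memP 𝒮 p₁ ∧ memP 𝒮 p₂ ∧ memP 𝒮 p₃ ∧
          SimE e' p₁ p ∧ SimE e' p₂ p ∧ SimE e' p₃ p ∧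
          ¬ SimE e p₁ p₂ ∧ ¬ SimE e p₁ p₃ ∧ ¬ SimE e p₂ p₃ ∧
          (∀ q, memP 𝒮 q → SimE e' q p → (SimE e q p₁ ∨ SimE e q p₂ ∨ SimE e q p₃)) ∧
          QCovByR 𝒮 (SimE e) p₃ p₁ ∧ QCovByR 𝒮 (SimE e) p₃ p₂) := by
  obtain ⟨S, F⟩ := p
  obtain ⟨z, w, hcol, hzw⟩ := hstep S
  refine or_iff_not_imp_left.2 fun hn => ?_
  push Not at hn
  obtain ⟨⟨T, G⟩, hq, hqp, hnq⟩ := hn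
  obtain rfl : T = S := hqp.1
  rename' T => S
  have hFG := (SimE'_iff_hits he he' S z w hzw G F).1 hqp
  have hne : ¬ e S z w := by
    intro h
    apply hnq
    rw [SimE_iff_hits3 he S z w]
    have a := Hits.congr he (F := F) h
    have b := Hits.congr he (F := G) h
    exact ⟨hFG.1, by tauto, by tauto⟩
  rw [SimE_iff_hits3 he S z w] at hnq
  obtain ⟨H, hH, hHz, hHk⟩ := h𝒮.E3 F hp.1 G hq.1 z.2
  have hHsub : ∀ x ∈ H, x ∈ F ∨ x ∈ G := by
    rintro ⟨i, k⟩ hx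
    by_cases hk : k = z.2
    · subst hk
      exact (hHz i).1 hx
    · rcases hHk k hk with h | h | h
      · exact Or.inl ((h i).1 hx)
      · exact Or.inr ((h i).1 hx)
      · exact (h i).1 hx
  have hHm : memP 𝒮 (S, H) := ⟨hH, fun i j hij => (hHsub _ hij).elim (hp.2 i j) (hq.2 i j)⟩
  have hHcol : ∀ b : R × E, b.2 = z.2 → (Hits e S H b ↔ Hits e S F b ∨ Hits e S G b) := by
    intro b hb
    constructor
    · rintro ⟨x, hx, h⟩
      exact (hHsub x hx).imp (fun h' => ⟨x, h', h⟩) (fun h' => ⟨x, h', h⟩)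
    · rintro (⟨⟨i, k⟩, hx, h⟩ | ⟨⟨i, k⟩, hx, h⟩)
      · obtain rfl : k = z.2 := (he.col _ _ _ h).trans hb
        exact ⟨_, (hHz i).2 (Or.inl hx), h⟩
      · obtain rfl : k = z.2 := (he.col _ _ _ h).trans hb
        exact ⟨_, (hHz i).2 (Or.inr hx), h⟩
  have hHo : ∀ b, ¬ e S b z → ¬ e S b w → (Hits e S H b ↔ Hits e S F b) := by
    intro b h1 h2
    have hb := hFG.1 b h1 h2
    by_cases hbz : b.2 = z.2
    · rw [hHcol b hbz, hb, or_self]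
    have aux : ∀ F' : Finset (R × E), (∀ i, (i, b.2) ∈ H ↔ (i, b.2) ∈ F') →
        (Hits e S H b ↔ Hits e S F' b) := by
      intro F' h
      constructor
      · rintro ⟨⟨i, k⟩, hx, hh⟩
        obtain rfl : k = b.2 := he.col _ _ _ hh
        exact ⟨_, (h i).1 hx, hh⟩
      · rintro ⟨⟨i, k⟩, hx, hh⟩
        obtain rfl : k = b.2 := he.col _ _ _ hh
        exact ⟨_, (h i).2 hx, hh⟩
    rcases hHk b.2 hbz with h | h | h
    · exact aux F h
    · rw [aux G h, hb]
    · have := aux (F ∪ G) (by simpa [Finset.mem_union] using h)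
      rw [this]
      constructor
      · rintro ⟨x, hx, hh⟩
        rcases Finset.mem_union.1 hx with h' | h'
        · exact ⟨x, h', hh⟩
        · exact hb.1 ⟨x, h', hh⟩
      · rintro ⟨x, hx, hh⟩
        exact ⟨x, Finset.mem_union_left _ hx, hh⟩
  have hz0 := hHcol z rfl
  have hw0 := hHcol w hcol.symm
  have hFG1 := hFG.1
  have hFG2 := hFG.2
  have hd : ¬ ((Hits e S G z ↔ Hits e S F z) ∧ (Hits e S G w ↔ Hits e S F w)) :=
    fun h => hnq ⟨hFG1, h⟩
  have hHz1 : Hits e S H z := by rw [hz0]; clear * - hd hFG2; tauto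
  have hHw1 : Hits e S H w := by rw [hw0]; clear * - hd hFG2; tauto
  have hFzw : Hits e S F z ∨ Hits e S F w := by clear * - hd hFG2; tauto
  have hne' : ¬ e S w z := fun h => hne (he.symm' _ _ _ h)
  obtain ⟨G1, hm1, hh1, hn1, hc1⟩ := remove_block h𝒮 he S z w hcol hne H hHm hHz1 hHw1
  obtain ⟨G2, hm2, hh2, hn2, hc2⟩ := remove_block h𝒮 he S w z hcol.symm hne' H hHm hHw1 hHz1
  have hG1z := (hh1 z hne).2 hHz1
  have hG2w := (hh2 w hne').2 hHw1
  have ho1 : ∀ b, ¬ e S b z → ¬ e S b w → (Hits e S G1 b ↔ Hits e S F b) := fun b h1 h2 => by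
    rw [hh1 b h2, hHo b h1 h2]
  have ho2 : ∀ b, ¬ e S b z → ¬ e S b w → (Hits e S G2 b ↔ Hits e S F b) := fun b h1 h2 => by
    rw [hh2 b h1, hHo b h1 h2]
  refine ⟨(S, G1), (S, G2), (S, H), hm1, hm2, hHm, ?_, ?_, ?_, ?_, ?_, ?_, ?_, hc1, hc2⟩
  · rw [SimE'_iff_hits he he' S z w hzw]
    exact ⟨ho1, fun _ => hFzw, fun _ => Or.inl hG1z⟩
  · rw [SimE'_iff_hits he he' S z w hzw]
    exact ⟨ho2, fun _ => hFzw, fun _ => Or.inr hG2w⟩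
  · rw [SimE'_iff_hits he he' S z w hzw]
    exact ⟨hHo, fun _ => hFzw, fun _ => Or.inl hHz1⟩
  · rw [SimE_iff_hits3 he S z w]; exact fun h => hn2 (h.2.1.1 hG1z)
  · rw [SimE_iff_hits3 he S z w]; exact fun h => hn1 (h.2.2.2 hHw1)
  · rw [SimE_iff_hits3 he S z w]; exact fun h => hn2 (h.2.1.2 hHz1)
  · rintro ⟨T, X⟩ hX hXp
    obtain rfl : T = S := hXp.1
    rename' T => S
    obtain ⟨k1, k2⟩ := (SimE'_iff_hits he he' S z w hzw X F).1 hXp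
    rw [SimE_iff_hits3 he S z w, SimE_iff_hits3 he S z w, SimE_iff_hits3 he S z w]
    have l1 : ∀ b, ¬ e S b z → ¬ e S b w → (Hits e S X b ↔ Hits e S G1 b) := fun b h1 h2 => by
      rw [k1 b h1 h2, ho1 b h1 h2]
    have l2 : ∀ b, ¬ e S b z → ¬ e S b w → (Hits e S X b ↔ Hits e S G2 b) := fun b h1 h2 => by
      rw [k1 b h1 h2, ho2 b h1 h2]
    have l3 : ∀ b, ¬ e S b z → ¬ e S b w → (Hits e S X b ↔ Hits e S H b) := fun b h1 h2 => by
      rw [k1 b h1 h2, hHo b h1 h2]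
    by_cases hXz : Hits e S X z <;> by_cases hXw : Hits e S X w
    · exact Or.inr (Or.inr ⟨l3, iff_of_true hXz hHz1, iff_of_true hXw hHw1⟩)
    · exact Or.inl ⟨l1, iff_of_true hXz hG1z, iff_of_false hXw hn1⟩
    · exact Or.inr (Or.inl ⟨l2, iff_of_false hXz hn2, iff_of_true hXw hG2w⟩)
    · exact absurd (k2.2 hFzw) (not_or.2 ⟨hXz, hXw⟩)

/-- The block relation after activating the positions of index `< m`. -/
def blk (A : R → E → SignType) (c : R × E → Finset (R × E)) (idx : R × E → ℕ) (m : ℕ)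
    (S : R → SignType) (x y : R × E) : Prop :=
  x = y ∨ (idx x < m ∧ idx y < m ∧ c x = c y ∧ S x.1 * A x.1 x.2 = S y.1 * A y.1 y.2)

theorem blk_good (A : R → E → SignType) (c : R × E → Finset (R × E)) (idx : R × E → ℕ) (m : ℕ)
    (hc : ∀ x y, c x = c y → x.2 = y.2) : GoodE (blk A c idx m) where
  rfl' S x := Or.inl rfl
  symm' S x y h := by
    rcases h with h | ⟨h1, h2, h3, h4⟩
    · exact Or.inl h.symm
    · exact Or.inr ⟨h2, h1, h3.symm, h4.symm⟩
  trans' S x y z h h' := by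
    rcases h with rfl | ⟨h1, h2, h3, h4⟩
    · exact h'
    · rcases h' with rfl | ⟨k1, k2, k3, k4⟩
      · exact Or.inr ⟨h1, h2, h3, h4⟩
      · exact Or.inr ⟨h1, k2, h3.trans k3, h4.trans k4⟩
  col S x y h := by
    rcases h with rfl | ⟨h1, h2, h3, h4⟩
    · rfl
    · exact hc _ _ h3
  up S T x y hST hx hy h := by
    unfold blk at *
    rwa [← hST _ hx, ← hST _ hy]
  down S T x y hST hx hy h := by
    unfold blk at *
    rwa [← hST _ hx, ← hST _ hy] at h

theorem blk_mono (A : R → E → SignType) (c : R × E → Finset (R × E)) (idx : R × E → ℕ) (m : ℕ) :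
    ∀ S x y, blk A c idx m S x y → blk A c idx (m + 1) S x y := by
  rintro S x y (h | ⟨h1, h2, h3⟩)
  · exact Or.inl h
  · exact Or.inr ⟨by omega, by omega, h3⟩

theorem blk_step (A : R → E → SignType) (c : R × E → Finset (R × E)) (idx : R × E → ℕ) (m : ℕ)
    (hc : ∀ x y, c x = c y → x.2 = y.2) (hidx : Function.Injective idx) (hm : ∃ z, idx z = m) :
    MergeStep (blk A c idx m) (blk A c idx (m + 1)) := by
  obtain ⟨z, hz⟩ := hm
  intro S
  have hlt : ∀ x, idx x < m + 1 ↔ idx x < m ∨ x = z := by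
    intro x
    constructor
    · intro h
      rcases Nat.lt_succ_iff_lt_or_eq.1 h with h | h
      · exact Or.inl h
      · exact Or.inr (hidx (h.trans hz.symm))
    · rintro (h | rfl) <;> omega
  have hzz : ∀ x, blk A c idx m S x z ↔ x = z := by
    intro x
    constructor
    · rintro (h | ⟨_, h, _⟩)
      · exact h
      · omega
    · exact fun h => Or.inl h
  by_cases hw : ∃ w, idx w < m ∧ c w = c z ∧ S w.1 * A w.1 w.2 = S z.1 * A z.1 z.2
  · obtain ⟨w, hw1, hw2, hw3⟩ := hw
    refine ⟨z, w, (hc _ _ hw2).symm, fun x y => ?_⟩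
    rw [hzz, hzz]
    constructor
    · rintro (h | ⟨h1, h2, h3, h4⟩)
      · exact Or.inl (Or.inl h)
      rcases (hlt x).1 h1 with h1 | rfl <;> rcases (hlt y).1 h2 with h2 | rfl
      · exact Or.inl (Or.inr ⟨h1, h2, h3, h4⟩)
      · exact Or.inr (Or.inr ⟨Or.inr ⟨h1, hw1, h3.trans hw2.symm, h4.trans hw3.symm⟩, rfl⟩)
      · exact Or.inr (Or.inl ⟨rfl, Or.inr ⟨h2, hw1, h3.symm.trans hw2.symm,
          h4.symm.trans hw3.symm⟩⟩)
      · exact Or.inl (Or.inl rfl)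
    · have hwz : blk A c idx (m + 1) S w z := Or.inr ⟨by omega, by omega, hw2, hw3⟩
      have G := blk_good A c idx (m + 1) hc
      rintro (h | ⟨rfl, h⟩ | ⟨h, rfl⟩)
      · exact blk_mono _ _ _ _ _ _ _ h
      · exact G.symm' _ _ _ (G.trans' _ _ _ _ (blk_mono _ _ _ _ _ _ _ h) hwz)
      · exact G.trans' _ _ _ _ (blk_mono _ _ _ _ _ _ _ h) hwz
  · refine ⟨z, z, rfl, fun x y => ?_⟩
    rw [hzz, hzz]
    constructor
    · rintro (h | ⟨h1, h2, h3, h4⟩)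
      · exact Or.inl (Or.inl h)
      rcases (hlt x).1 h1 with h1 | rfl <;> rcases (hlt y).1 h2 with h2 | rfl
      · exact Or.inl (Or.inr ⟨h1, h2, h3, h4⟩)
      · exact absurd ⟨x, h1, h3, h4⟩ hw
      · exact absurd ⟨y, h2, h3.symm, h4.symm⟩ hw
      · exact Or.inl (Or.inl rfl)
    · rintro (h | ⟨rfl, rfl⟩ | ⟨rfl, rfl⟩)
      · exact blk_mono _ _ _ _ _ _ _ h
      · exact Or.inl rfl
      · exact Or.inl rfl

theorem blk_last (A : R → E → SignType) (hA : ∀ i j, A i j ≠ 0)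
    (Pa : Finset (Finset (R × E))) (c : R × E → Finset (R × E))
    (hc : ∀ x, c x ∈ Pa) (hc' : ∀ π ∈ Pa, ∀ x, x ∈ π ↔ c x = π)
    (idx : R × E → ℕ) (m : ℕ) (hidx : ∀ x, idx x < m)
    {p q : (R → SignType) × Finset (R × E)} (hp : memP 𝒮 p) (hq : memP 𝒮 q) :
    SimE (blk A c idx m) p q ↔ SimA A Pa p q := by
  obtain ⟨S, F⟩ := p
  obtain ⟨T, G⟩ := q
  have hb : ∀ S x y, blk A c idx m S x y ↔
      c x = c y ∧ S x.1 * A x.1 x.2 = S y.1 * A y.1 y.2 := by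
    intro S x y
    constructor
    · rintro (rfl | ⟨_, _, h⟩)
      · exact ⟨rfl, rfl⟩
      · exact h
    · exact fun h => Or.inr ⟨hidx _, hidx _, h⟩
  have hSA : ∀ (S : R → SignType) (F : Finset (R × E)) x s, s ≠ 0 →
      (SA A S F x = s ↔ x ∈ F ∧ S x.1 * A x.1 x.2 = s) := by
    intro S F x s hs
    unfold SA
    split_ifs with h
    · simp [h]
    · simp [h, hs.symm]
  have hnz : ∀ (S : R → SignType) (F : Finset (R × E)), memP 𝒮 (S, F) → ∀ x ∈ F,
      S x.1 * A x.1 x.2 ≠ 0 := fun S F h x hx => mul_ne_zero (h.2 x.1 x.2 hx) (hA _ _)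
  constructor
  · rintro ⟨h1, h2, h3⟩
    obtain rfl : S = T := h1
    refine ⟨rfl, fun π hπ s hs => ⟨?_, ?_⟩⟩
    · rintro ⟨x, hx, hxs⟩
      obtain ⟨hxF, hxs⟩ := (hSA _ _ _ _ hs).1 hxs
      obtain ⟨y, hy, hxy⟩ := h2 x hxF
      obtain ⟨k1, k2⟩ := (hb _ _ _).1 hxy
      exact ⟨y, (hc' π hπ y).2 (k1.symm.trans ((hc' π hπ x).1 hx)),
        (hSA _ _ _ _ hs).2 ⟨hy, k2.symm.trans hxs⟩⟩
    · rintro ⟨x, hx, hxs⟩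
      obtain ⟨hxF, hxs⟩ := (hSA _ _ _ _ hs).1 hxs
      obtain ⟨y, hy, hxy⟩ := h3 x hxF
      obtain ⟨k1, k2⟩ := (hb _ _ _).1 hxy
      exact ⟨y, (hc' π hπ y).2 (k1.trans ((hc' π hπ x).1 hx)),
        (hSA _ _ _ _ hs).2 ⟨hy, k2.trans hxs⟩⟩
  · rintro ⟨h1, h2⟩
    obtain rfl : S = T := h1
    refine ⟨rfl, fun x hx => ?_, fun x hx => ?_⟩
    · have hs := hnz S F hp x hx
      obtain ⟨y, hy, hys⟩ := (h2 (c x) (hc x) _ hs).1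
        ⟨x, (hc' _ (hc x) x).2 rfl, (hSA _ _ _ _ hs).2 ⟨hx, rfl⟩⟩
      obtain ⟨hyG, hys⟩ := (hSA _ _ _ _ hs).1 hys
      exact ⟨y, hyG, (hb _ _ _).2 ⟨((hc' _ (hc x) y).1 hy).symm, hys.symm⟩⟩
    · have hs := hnz S G hq x hx
      obtain ⟨y, hy, hys⟩ := (h2 (c x) (hc x) _ hs).2
        ⟨x, (hc' _ (hc x) x).2 rfl, (hSA _ _ _ _ hs).2 ⟨hx, rfl⟩⟩
      obtain ⟨hyG, hys⟩ := (hSA _ _ _ _ hs).1 hys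
      exact ⟨y, hyG, (hb _ _ _).2 ⟨(hc' _ (hc x) y).1 hy, hys⟩⟩

end helpers

theorem statement8 {R E : Type*} [Fintype R] [Fintype E] [DecidableEq R] [DecidableEq E]
    (𝒮 : Set (Finset (R × E))) (h𝒮 : IsElimSystem 𝒮)
    (A : R → E → SignType) (hA : ∀ i j, A i j ≠ 0)
    (Pa : Finset (Finset (R × E))) (hPa : IsColPartition Pa) :
    ∃ (k : ℕ)
      (rel : ℕ → ((R → SignType) × Finset (R × E)) → ((R → SignType) × Finset (R × E)) → Prop),
      -- `P₀ = P(𝒮)`: `rel 0` is equality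
      (∀ p q, memP 𝒮 p → memP 𝒮 q → (rel 0 p q ↔ p = q)) ∧
      -- `P_k = P(𝒮)/∼_A`: `rel k` is `∼_A`
      (∀ p q, memP 𝒮 p → memP 𝒮 q → (rel k p q ↔ SimA A Pa p q)) ∧
      -- each `rel i` is an equivalence relation on `P(𝒮)`
      (∀ i ≤ k, (∀ p, memP 𝒮 p → rel i p p) ∧
        (∀ p q, memP 𝒮 p → memP 𝒮 q → rel i p q → rel i q p) ∧
        (∀ p q x, memP 𝒮 p → memP 𝒮 q → memP 𝒮 x →
          rel i p q → rel i q x → rel i p x)) ∧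
      -- each `rel (i+1)` coarsens `rel i`, so `P_{i+1}` is a quotient of `P_i`
      (∀ i < k, ∀ p q, memP 𝒮 p → memP 𝒮 q → rel i p q → rel (i + 1) p q) ∧
      -- the relation induced by `rel (i+1)` on `P_i` is `P_i`-homogeneous
      (∀ i < k, ∀ p q u, memP 𝒮 p → memP 𝒮 q → memP 𝒮 u →
        QLeR 𝒮 (rel i) p q → rel (i + 1) u p →
        ∃ v, memP 𝒮 v ∧ rel (i + 1) v q ∧ QLeR 𝒮 (rel i) u v) ∧
      -- the quotient `P_{i+1}` of `P_i` is elementary: each induced class is a singleton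
      -- or consists of exactly three elements of `P_i`, two of which cover the third
      (∀ i < k, ∀ p, memP 𝒮 p →
        (∀ q, memP 𝒮 q → rel (i + 1) q p → rel i q p) ∨
        (∃ p₁ p₂ p₃, memP 𝒮 p₁ ∧ memP 𝒮 p₂ ∧ memP 𝒮 p₃ ∧
          rel (i + 1) p₁ p ∧ rel (i + 1) p₂ p ∧ rel (i + 1) p₃ p ∧
          ¬ rel i p₁ p₂ ∧ ¬ rel i p₁ p₃ ∧ ¬ rel i p₂ p₃ ∧
          (∀ q, memP 𝒮 q → rel (i + 1) q p → (rel i q p₁ ∨ rel i q p₂ ∨ rel i q p₃)) ∧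
          QCovByR 𝒮 (rel i) p₃ p₁ ∧ QCovByR 𝒮 (rel i) p₃ p₂)) ∧
      -- for `i = 0, …, k-1`, the augmented poset `L(P_i)` is a lattice
      (∀ i < k, ∀ a ∈ AugSet 𝒮, ∀ b ∈ AugSet 𝒮,
        (∃ g, IsGLBIn (AugLe (QLeR 𝒮 (rel i))) (AugSet 𝒮) a b g) ∧
        (∃ u, IsLUBIn (AugLe (QLeR 𝒮 (rel i))) (AugSet 𝒮) a b u)) := by
  obtain ⟨hne, hex, hcol⟩ := hPa
  choose c hc hcu using hex
  have hc' : ∀ π ∈ Pa, ∀ x, x ∈ π ↔ c x = π := by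
    intro π hπ x
    constructor
    · exact fun h => (hcu x π ⟨hπ, h⟩).symm
    · rintro rfl
      exact (hc x).2
  have hcc : ∀ x y, c x = c y → x.2 = y.2 := by
    intro x y h
    exact hcol (c x) (hc x).1 x (hc x).2 y (h ▸ (hc y).2)
  let f := Fintype.equivFin (R × E)
  let idx : R × E → ℕ := fun x => (f x : ℕ)
  have hidx : Function.Injective idx := fun x y h => f.injective (Fin.ext h)
  have good := fun m => blk_good A c idx m hcc
  refine ⟨Fintype.card (R × E), fun m => SimE (blk A c idx m), ?_, ?_, ?_, ?_, ?_, ?_, ?_⟩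
  · intro p q _ _
    constructor
    · rintro ⟨h1, h2, h3⟩
      refine Prod.ext h1 (Finset.Subset.antisymm (fun x hx => ?_) (fun x hx => ?_))
      · obtain ⟨y, hy, rfl | ⟨h, _⟩⟩ := h2 x hx
        · exact hy
        · omega
      · obtain ⟨y, hy, rfl | ⟨h, _⟩⟩ := h3 x hx
        · exact hy
        · omega
    · rintro rfl
      exact SimE.refl' (good 0) p
  · intro p q hp hq
    exact blk_last A hA Pa c (fun x => (hc x).1) hc' idx _ (fun x => (f x).2) hp hq
  · intro m _
    exact ⟨fun p _ => SimE.refl' (good m) p, fun p q _ _ h => SimE.symm' (good m) h,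
      fun p q x _ _ _ h h' => SimE.trans' (good m) h h'⟩
  · intro m _ p q _ _ h
    exact SimE.mono (blk_mono A c idx m) h
  · intro m _ p q u hp hq hu h h'
    exact step_homog h𝒮 (good m) (good (m + 1)) (blk_mono A c idx m) hp hq hu h h'
  · intro m hm p hp
    exact step_elem h𝒮 (good m) (good (m + 1))
      (blk_step A c idx m hcc hidx ⟨f.symm ⟨m, hm⟩, by simp [idx]⟩) p hp
  · intro m _
    exact aug_lattice h𝒮 (good m)
end

section
/- Let 𝒮 be an elimination system on R×E and A ∈ {-1,+1}^{R×E}. If (S,F) ≤ (T,G) in P(𝒮), then S ≤ T and ψ_A(S,F) ≤ ψ_A(T,G), where sign vectors on E are ordered by X ≤ Y iff X_j = Y_j for every j with X_j ≠ 0. In other words, the map (S,F) ↦ (S, ψ_A(S,F)) is order-preserving from P(𝒮) to {-1,0,+1}^R × {-1,0,+1}^E with the componentwise sign-vector order. -/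
/-! Statement 9: the map `(S,F) ↦ (S, ψ_A(S,F))` is order-preserving from `P(𝒮)` to
sign vectors with the componentwise sign-vector order. -/

open Classical in
/-- `ψ_A(S,F) ∈ {-1,0,+1}^E`: the sign pattern of the columns of `SA_F`. -/
noncomputable def psiA {R E : Type*} [Fintype R] (A : R → E → SignType)
    (S : R → SignType) (F : Finset (R × E)) : E → SignType := fun j =>
  if (∃ i, (i, j) ∈ F ∧ S i * A i j = 1) ∧ ¬ (∃ i, (i, j) ∈ F ∧ S i * A i j = -1) then 1
  else if (∃ i, (i, j) ∈ F ∧ S i * A i j = -1) ∧ ¬ (∃ i, (i, j) ∈ F ∧ S i * A i j = 1) then -1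
  else 0

/-- Propositional core of the argument. -/
theorem sign_core (a b c d : Prop) {_ : Decidable (a ∧ ¬ b)} {_ : Decidable (b ∧ ¬ a)}
    {_ : Decidable (c ∧ ¬ d)} {_ : Decidable (d ∧ ¬ c)} (m1 : a → c) (m2 : b → d) (ex : a ∨ b)
    (hj : (if c ∧ ¬ d then (1 : SignType) else if d ∧ ¬ c then -1 else 0) ≠ 0) :
    (if c ∧ ¬ d then (1 : SignType) else if d ∧ ¬ c then -1 else 0) =
      if a ∧ ¬ b then (1 : SignType) else if b ∧ ¬ a then -1 else 0 := by
  by_cases ha : a <;> by_cases hb : b <;> by_cases hc : c <;> by_cases hd : d <;> simp_all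

theorem statement9 {R E : Type*} [Fintype R] [Fintype E]
    (𝒮 : Set (Finset (R × E))) (h𝒮 : IsElimSystem 𝒮)
    (A : R → E → SignType) (hA : ∀ i j, A i j ≠ 0)
    (p q : (R → SignType) × Finset (R × E)) (hp : memP 𝒮 p) (hq : memP 𝒮 q)
    (hle : PLe p q) :
    SVLe p.1 q.1 ∧ SVLe (psiA A p.1 p.2) (psiA A q.1 q.2) := by
  refine ⟨hle.1, ?_⟩
  intro j hj
  obtain ⟨i, hi⟩ := h𝒮.E1 q.2 hq.1 j
  -- entries of column j in `q` are entries of column j in `p`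
  have key : ∀ i, (i, j) ∈ q.2 → (i, j) ∈ p.2 ∧ p.1 i = q.1 i := fun i hi =>
    ⟨hle.2 hi, hle.1 i (hp.2 i j (hle.2 hi))⟩
  have tri : q.1 i * A i j = 1 ∨ q.1 i * A i j = -1 := by
    have h1 := hq.2 i j hi
    have h2 := hA i j
    revert h1 h2
    generalize q.1 i = a
    generalize A i j = b
    revert a b
    decide
  have mono : ∀ s : SignType, (∃ i, (i, j) ∈ q.2 ∧ q.1 i * A i j = s) →
      ∃ i, (i, j) ∈ p.2 ∧ p.1 i * A i j = s := by
    rintro s ⟨k, hk, hs⟩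
    exact ⟨k, (key k hk).1, by rw [(key k hk).2]; exact hs⟩
  have m1 := mono 1
  have m2 := mono (-1)
  have ex : (∃ i, (i, j) ∈ q.2 ∧ q.1 i * A i j = 1) ∨
      (∃ i, (i, j) ∈ q.2 ∧ q.1 i * A i j = -1) :=
    tri.imp (fun h => ⟨i, hi, h⟩) (fun h => ⟨i, hi, h⟩)
  unfold psiA at hj ⊢
  exact sign_core _ _ _ _ m1 m2 ex hj
end
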